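/- arXiv:1611.01252 — 2 statements merged into one kernel-verified Lean document; each statement's English description precedes it below -/
import Mathlib

section
/- Let d ≥ 1 and let c be an integer with 1 ≤ c ≤ d. For every p > 1 there is a constant C > 0, depending only on d, c and p, such that for every weight w on ℝ^d, setting W = 𝔐_c 𝔐_{c-1} ⋯ 𝔐_1 w, one has ‖𝔐_c f‖_{L^p(ℝ^d, w)} ≤ C ‖f‖_{L^p(ℝ^d, W)} for every locally integrable f. -/
open MeasureTheory ENNReal

/-- The strong maximal operator of complexity `c` in `ℝ^d`, acting on `ℝ≥0∞`-valued
functions: the supremum of averages over all axis-parallel rectangles (boxes) containing `x`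
whose side lengths take at most `c` distinct values. -/
noncomputable def strongMaximal (d c : ℕ) (f : (Fin d → ℝ) → ℝ≥0∞) (x : Fin d → ℝ) : ℝ≥0∞ :=
  ⨆ (a : Fin d → ℝ) (b : Fin d → ℝ) (_ : ∀ i, a i < b i)
    (_ : (Finset.image (fun i => b i - a i) Finset.univ).card ≤ c)
    (_ : x ∈ Set.Icc a b),
      (∫⁻ y in Set.Icc a b, f y) / volume (Set.Icc a b)

/-- `iterMaximal d c w = 𝔐_c 𝔐_{c-1} ⋯ 𝔐_1 w`. -/
noncomputable def iterMaximal (d : ℕ) : ℕ → ((Fin d → ℝ) → ℝ≥0∞) → ((Fin d → ℝ) → ℝ≥0∞)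
  | 0, g => g
  | c + 1, g => strongMaximal d (c + 1) (iterMaximal d c g)

theorem measure_biUnion_le_of_forall_finset {X ι : Type*} [MeasurableSpace X] {μ : Measure X}
    {s : Set ι} (hs : s.Countable) {R : ι → Set X} {K : ℝ≥0∞}
    (h : ∀ F : Finset ι, (F : Set ι) ⊆ s → μ (⋃ i ∈ F, R i) ≤ K) :
    μ (⋃ i ∈ s, R i) ≤ K := by
  classical
  have : Countable s := hs.to_subtype
  have hU : (⋃ i ∈ s, R i) = ⋃ F : Finset s, ⋃ i ∈ F, R i := by
    ext x
    simp only [Set.mem_iUnion, exists_prop]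
    constructor
    · rintro ⟨i, hi, hx⟩
      exact ⟨{⟨i, hi⟩}, ⟨i, hi⟩, by simp, hx⟩
    · rintro ⟨F, i, -, hx⟩
      exact ⟨i, i.2, hx⟩
  have hd : Directed (· ⊆ ·) fun F : Finset s => ⋃ i ∈ F, R i := by
    intro F G
    refine ⟨F ∪ G, ?_, ?_⟩ <;> refine Set.biUnion_subset_biUnion_left ?_ <;> intro i hi
    · exact Finset.mem_union_left _ hi
    · exact Finset.mem_union_right _ hi
  rw [hU, hd.measure_iUnion]
  refine iSup_le fun F => ?_
  refine le_trans (measure_mono ?_) (h (F.image Subtype.val) ?_)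
  · intro x hx
    simp only [Set.mem_iUnion, exists_prop] at hx ⊢
    obtain ⟨i, hi, hx⟩ := hx
    exact ⟨i, Finset.mem_image_of_mem _ hi, hx⟩
  · intro i hi
    simp only [Finset.coe_image, Set.mem_image] at hi
    obtain ⟨j, -, rfl⟩ := hi
    exact j.2

theorem measure_biUnion_le_of_forall_finset_of_isOpen {X ι : Type*} [TopologicalSpace X]
    [SecondCountableTopology X] [MeasurableSpace X] {μ : Measure X} {s : Set ι}
    {R : ι → Set X} (hR : ∀ i ∈ s, IsOpen (R i)) {K : ℝ≥0∞}
    (h : ∀ F : Finset ι, (F : Set ι) ⊆ s → μ (⋃ i ∈ F, R i) ≤ K) :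
    μ (⋃ i ∈ s, R i) ≤ K := by
  obtain ⟨T, hTs, hT, hU⟩ := TopologicalSpace.isOpen_biUnion_countable s R hR
  rw [← hU]
  exact measure_biUnion_le_of_forall_finset hT fun F hF => h F (hF.trans hTs)

theorem ENNReal.rpow_eq_lintegral_Ioi {r : ℝ} (hr : 0 < r) (x : ℝ≥0∞) :
    x ^ r = ENNReal.ofReal r * ∫⁻ t in Set.Ioi (0 : ℝ),
      {t | ENNReal.ofReal t < x}.indicator (fun t => ENNReal.ofReal (t ^ (r - 1))) t := by
  have key : ∀ y : ℝ, 0 ≤ y → ENNReal.ofReal y ^ r = ENNReal.ofReal r *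
      ∫⁻ t in Set.Ioi (0 : ℝ), {t | ENNReal.ofReal t < ENNReal.ofReal y}.indicator
        (fun t => ENNReal.ofReal (t ^ (r - 1))) t := by
    intro y hy
    have h := lintegral_rpow_eq_lintegral_meas_lt_mul (Measure.dirac ()) (f := fun _ => y)
      (Filter.Eventually.of_forall fun _ => hy) aemeasurable_const hr
    rw [lintegral_const, measure_univ, mul_one] at h
    rw [ENNReal.ofReal_rpow_of_nonneg hy hr.le, h]
    congr 1
    refine setLIntegral_congr_fun measurableSet_Ioi fun t ht => ?_
    have ht : 0 < t := ht
    by_cases hty : t < y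
    · have : ENNReal.ofReal t < ENNReal.ofReal y :=
        (ENNReal.ofReal_lt_ofReal_iff (ht.trans hty)).2 hty
      simp [hty, this]
    · have : ¬ ENNReal.ofReal t < ENNReal.ofReal y :=
        not_lt.2 (ENNReal.ofReal_le_ofReal (not_lt.1 hty))
      simp [hty, this]
  rcases eq_or_ne x ⊤ with rfl | hx
  · rw [ENNReal.top_rpow_of_pos hr]
    refine (ENNReal.eq_top_of_forall_nnreal_le fun n => ?_).symm
    have h1 := key ((n : ℝ) ^ (r⁻¹)) (by positivity)
    rw [ENNReal.ofReal_rpow_of_nonneg (by positivity) hr.le, ← Real.rpow_mul (NNReal.coe_nonneg n),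
      inv_mul_cancel₀ hr.ne', Real.rpow_one, ENNReal.ofReal_coe_nnreal] at h1
    rw [h1]
    gcongr with t
    simp
  · have := key x.toReal ENNReal.toReal_nonneg
    rwa [ENNReal.ofReal_toReal hx] at this

/-- A form of the Marcinkiewicz interpolation argument between weak type `(q, q)` and `L^∞`. -/
theorem exists_lintegral_rpow_le_of_weak_type {q p : ℝ} (hq : 0 < q) (hqp : q < p)
    {A : ℝ≥0∞} (hA : A ≠ ⊤) :
    ∃ K : ℝ≥0∞, K ≠ ⊤ ∧ ∀ {X : Type} [MeasurableSpace X] (μ ν : Measure X) [SFinite μ] [SFinite ν]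
      (f F : X → ℝ≥0∞), Measurable f → Measurable F →
      (∀ t : ℝ, 0 < t → ENNReal.ofReal t ^ q * μ {x | ENNReal.ofReal t < F x} ≤
        A * ∫⁻ x in {x | ENNReal.ofReal t < 2 * f x}, f x ^ q ∂ν) →
      ∫⁻ x, F x ^ p ∂μ ≤ K * ∫⁻ x, f x ^ p ∂ν := by
  have hp : 0 < p := hq.trans hqp
  have hr : 0 < p - q := sub_pos.2 hqp
  refine ⟨ENNReal.ofReal p * (A * ((ENNReal.ofReal (p - q))⁻¹ * 2 ^ (p - q))), ?_, ?_⟩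
  · refine ENNReal.mul_ne_top ENNReal.ofReal_ne_top (ENNReal.mul_ne_top hA
      (ENNReal.mul_ne_top ?_ ?_))
    · simpa using hqp
    · exact ENNReal.rpow_ne_top_of_nonneg hr.le (by simp)
  intro X _ μ ν _ _ f F hf hF hw
  have hmeasF : MeasurableSet {z : X × ℝ | ENNReal.ofReal z.2 < F z.1} :=
    measurableSet_lt (by fun_prop) (by fun_prop)
  have hmeasf : MeasurableSet {z : ℝ × X | ENNReal.ofReal z.1 < 2 * f z.2} :=
    measurableSet_lt (by fun_prop) (by fun_prop)
  have hmt : ∀ s : ℝ, Measurable fun t : ℝ => ENNReal.ofReal (t ^ s) := fun s => by fun_prop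
  calc ∫⁻ x, F x ^ p ∂μ
      = ENNReal.ofReal p * ∫⁻ x, (∫⁻ t in Set.Ioi (0 : ℝ),
          {t | ENNReal.ofReal t < F x}.indicator (fun t => ENNReal.ofReal (t ^ (p - 1))) t) ∂μ := by
        rw [← lintegral_const_mul' _ _ ENNReal.ofReal_ne_top]
        exact lintegral_congr fun x => ENNReal.rpow_eq_lintegral_Ioi hp _
    _ = ENNReal.ofReal p * ∫⁻ t in Set.Ioi (0 : ℝ), ∫⁻ x, {t | ENNReal.ofReal t < F x}.indicator
          (fun t => ENNReal.ofReal (t ^ (p - 1))) t ∂μ := by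
        rw [lintegral_lintegral_swap]
        exact (((hmt _).comp measurable_snd).indicator hmeasF).aemeasurable
    _ = ENNReal.ofReal p * ∫⁻ t in Set.Ioi (0 : ℝ),
          ENNReal.ofReal (t ^ (p - 1)) * μ {x | ENNReal.ofReal t < F x} := by
        congr 1
        refine lintegral_congr fun t => ?_
        rw [← lintegral_indicator_const (measurableSet_lt measurable_const hF)]
        rfl
    _ ≤ ENNReal.ofReal p * ∫⁻ t in Set.Ioi (0 : ℝ), A * ∫⁻ x,
          f x ^ q * {t | ENNReal.ofReal t < 2 * f x}.indicator
            (fun t => ENNReal.ofReal (t ^ (p - q - 1))) t ∂ν := by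
        refine mul_le_mul_right (setLIntegral_mono' measurableSet_Ioi fun t ht => ?_) _
        have ht : 0 < t := ht
        have h1 : ENNReal.ofReal (t ^ (p - 1)) =
            ENNReal.ofReal (t ^ (p - q - 1)) * ENNReal.ofReal t ^ q := by
          rw [ENNReal.ofReal_rpow_of_pos ht, ← ENNReal.ofReal_mul (by positivity),
            ← Real.rpow_add ht]
          ring_nf
        have h2 : ∫⁻ x, f x ^ q * {t | ENNReal.ofReal t < 2 * f x}.indicator
            (fun t => ENNReal.ofReal (t ^ (p - q - 1))) t ∂ν = ENNReal.ofReal (t ^ (p - q - 1)) *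
            ∫⁻ x in {x | ENNReal.ofReal t < 2 * f x}, f x ^ q ∂ν := by
          rw [← lintegral_indicator (measurableSet_lt measurable_const (by fun_prop)),
            ← lintegral_const_mul' _ _ ENNReal.ofReal_ne_top]
          refine lintegral_congr fun x => ?_
          by_cases hx : ENNReal.ofReal t < 2 * f x <;> simp [Set.indicator, hx, mul_comm (f x ^ q)]
        rw [h1, h2, mul_assoc, mul_left_comm A]
        exact mul_le_mul_right (hw t ht) _
    _ = ENNReal.ofReal p * (A * ∫⁻ x, (∫⁻ t in Set.Ioi (0 : ℝ),
          f x ^ q * {t | ENNReal.ofReal t < 2 * f x}.indicator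
            (fun t => ENNReal.ofReal (t ^ (p - q - 1))) t) ∂ν) := by
        rw [lintegral_const_mul' _ _ hA, lintegral_lintegral_swap]
        exact ((by fun_prop : Measurable fun z : ℝ × X => f z.2 ^ q).mul
          (((hmt _).comp measurable_fst).indicator hmeasf)).aemeasurable
    _ ≤ ENNReal.ofReal p * (A * ∫⁻ x,
          ((ENNReal.ofReal (p - q))⁻¹ * 2 ^ (p - q)) * f x ^ p ∂ν) := by
        gcongr with x
        have hmx : Measurable ({t | ENNReal.ofReal t < 2 * f x}.indicator
            (fun t => ENNReal.ofReal (t ^ (p - q - 1)))) :=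
          (hmt _).indicator (measurableSet_lt (by fun_prop) (by fun_prop))
        have hne : ENNReal.ofReal (p - q) ≠ 0 := by simpa using hqp
        have h3 := ENNReal.rpow_eq_lintegral_Ioi hr (2 * f x)
        rw [lintegral_const_mul _ hmx]
        have h4 : ∫⁻ t in Set.Ioi (0 : ℝ), {t | ENNReal.ofReal t < 2 * f x}.indicator
            (fun t => ENNReal.ofReal (t ^ (p - q - 1))) t =
            (ENNReal.ofReal (p - q))⁻¹ * (2 * f x) ^ (p - q) := by
          rw [h3, ← mul_assoc, ENNReal.inv_mul_cancel hne ENNReal.ofReal_ne_top, one_mul]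
        rw [h4, ENNReal.mul_rpow_of_nonneg _ _ hr.le]
        have h5 : f x ^ p = f x ^ q * f x ^ (p - q) := by
          rw [← ENNReal.rpow_add_of_nonneg _ _ hq.le hr.le]; ring_nf
        rw [h5]
        apply le_of_eq; ring
    _ = _ := by
        rw [lintegral_const_mul]
        · ring
        · fun_prop

/-- The Hardy–Littlewood maximal function on the line, over intervals with rational endpoints. -/
noncomputable def lineMaximal (g : ℝ → ℝ≥0∞) (x : ℝ) : ℝ≥0∞ :=
  ⨆ r : ℚ × ℚ, ⨆ (_ : x ∈ Set.Ioo (r.1 : ℝ) r.2),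
    (∫⁻ s in Set.Ioo (r.1 : ℝ) r.2, g s) / ENNReal.ofReal (r.2 - r.1)

theorem measurable_lineMaximal (g : ℝ → ℝ≥0∞) : Measurable (lineMaximal g) := by
  refine Measurable.iSup fun r => ?_
  have : (fun x : ℝ => ⨆ (_ : x ∈ Set.Ioo (r.1 : ℝ) r.2),
      (∫⁻ s in Set.Ioo (r.1 : ℝ) r.2, g s) / ENNReal.ofReal (r.2 - r.1)) =
      (Set.Ioo (r.1 : ℝ) r.2).indicator
        fun _ => (∫⁻ s in Set.Ioo (r.1 : ℝ) r.2, g s) / ENNReal.ofReal (r.2 - r.1) := by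
    ext x
    by_cases hx : x ∈ Set.Ioo (r.1 : ℝ) r.2 <;> simp only [hx, iSup_pos, iSup_neg,
      Set.indicator_of_mem, Set.indicator_of_notMem, not_false_eq_true, bot_eq_zero]
  rw [this]
  exact measurable_const.indicator measurableSet_Ioo

theorem lintegral_Ioo_le_lineMaximal (g : ℝ → ℝ≥0∞) {a b x : ℝ} (hx : x ∈ Set.Ioo a b) :
    ∫⁻ s in Set.Ioo a b, g s ≤ 2 * ENNReal.ofReal (b - a) * lineMaximal g x := by
  have hab : a < b := hx.1.trans hx.2
  obtain ⟨u, hu1, hu2⟩ := exists_rat_btwn (show a - (b - a) / 2 < a by linarith)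
  obtain ⟨v, hv1, hv2⟩ := exists_rat_btwn (show b < b + (b - a) / 2 by linarith)
  have huv : 0 < (v : ℝ) - u := by linarith
  calc ∫⁻ s in Set.Ioo a b, g s ≤ ∫⁻ s in Set.Ioo (u : ℝ) v, g s :=
        lintegral_mono_set (Set.Ioo_subset_Ioo hu2.le hv1.le)
    _ = ENNReal.ofReal (v - u) *
          ((∫⁻ s in Set.Ioo (u : ℝ) v, g s) / ENNReal.ofReal (v - u)) := by
        rw [ENNReal.mul_div_cancel (by simpa using huv) ENNReal.ofReal_ne_top]
    _ ≤ ENNReal.ofReal (2 * (b - a)) * lineMaximal g x := by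
        gcongr
        · linarith
        · exact le_iSup₂_of_le (u, v) ⟨hu2.trans hx.1, hx.2.trans hv1⟩ le_rfl
    _ = _ := by rw [ENNReal.ofReal_mul (by norm_num)]; norm_num

theorem lineMaximal_weak_type (g : ℝ → ℝ≥0∞) {t : ℝ≥0∞} :
    t * volume {x | t < lineMaximal g x} ≤ 5 * ∫⁻ s, g s := by
  classical
  rcases eq_or_ne t 0 with rfl | ht0
  · simp
  rcases eq_or_ne t ⊤ with rfl | ht
  · simp
  set S : Set (ℚ × ℚ) := {r | r.1 < r.2 ∧
    t * ENNReal.ofReal (r.2 - r.1) < ∫⁻ s in Set.Ioo (r.1 : ℝ) r.2, g s}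
  have hU : {x | t < lineMaximal g x} ⊆ ⋃ r ∈ S, Set.Ioo (r.1 : ℝ) r.2 := by
    intro x hx
    obtain ⟨r, hr⟩ := lt_iSup_iff.1 (show t < lineMaximal g x from hx)
    obtain ⟨hxr, hr⟩ := lt_iSup_iff.1 hr
    refine Set.mem_iUnion₂.2 ⟨r, ⟨?_, ?_⟩, hxr⟩
    · exact_mod_cast hxr.1.trans hxr.2
    · exact (ENNReal.lt_div_iff_mul_lt (Or.inr ht) (by simp)).1 hr
  rw [mul_comm, ← ENNReal.le_div_iff_mul_le (Or.inl ht0) (Or.inl ht)]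
  refine (measure_mono hU).trans
    (measure_biUnion_le_of_forall_finset_of_isOpen (fun _ _ => isOpen_Ioo) fun F hF => ?_)
  rw [ENNReal.le_div_iff_mul_le (Or.inl ht0) (Or.inl ht)]
  obtain ⟨M, hM⟩ := (F.image fun r : ℚ × ℚ => (r.2 - r.1 : ℝ)).bddAbove
  have hpos : ∀ r ∈ F, (0 : ℝ) < r.2 - r.1 := fun r hr => by
    have : (r.1 : ℝ) < r.2 := by exact_mod_cast (hF hr).1
    linarith
  obtain ⟨u, huF, hdisj, hcov⟩ := Vitali.exists_disjoint_subfamily_covering_enlargement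
    (fun r : ℚ × ℚ => Set.Ioo (r.1 : ℝ) r.2) (F : Set (ℚ × ℚ)) (fun r => (r.2 - r.1 : ℝ)) 2
    (by norm_num) (fun r hr => (hpos r hr).le) M
    (fun r hr => hM (Finset.mem_coe.2 (Finset.mem_image_of_mem _ hr)))
    (fun r hr => Set.nonempty_Ioo.2 (sub_pos.1 (hpos r hr)))
  have hufin : u.Finite := F.finite_toSet.subset huF
  lift u to Finset (ℚ × ℚ) using hufin
  have hsub : (⋃ r ∈ F, Set.Ioo (r.1 : ℝ) r.2) ⊆
      ⋃ r ∈ u, Set.Ioo (r.1 - 2 * (r.2 - r.1) : ℝ) (r.2 + 2 * (r.2 - r.1)) := by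
    refine Set.iUnion₂_subset fun r hr x hx => ?_
    obtain ⟨b, hb, ⟨y, hy1, hy2⟩, hle⟩ := hcov r hr
    simp only [Set.mem_Ioo] at hx hy1 hy2
    exact Set.mem_iUnion₂.2 ⟨b, hb, by linarith, by linarith⟩
  calc volume (⋃ r ∈ F, Set.Ioo (r.1 : ℝ) r.2) * t
      ≤ (∑ r ∈ u, 5 * ENNReal.ofReal (r.2 - r.1)) * t := by
        gcongr
        refine (measure_mono hsub).trans ((measure_biUnion_finset_le _ _).trans ?_)
        refine Finset.sum_le_sum fun r _ => ?_
        rw [Real.volume_Ioo, show (5 : ℝ≥0∞) = ENNReal.ofReal 5 by norm_num,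
          ← ENNReal.ofReal_mul (by norm_num)]
        apply ENNReal.ofReal_le_ofReal; linarith
    _ = 5 * ∑ r ∈ u, t * ENNReal.ofReal (r.2 - r.1) := by
        rw [Finset.sum_mul, Finset.mul_sum]
        exact Finset.sum_congr rfl fun r _ => by ring
    _ ≤ 5 * ∑ r ∈ u, ∫⁻ s in Set.Ioo (r.1 : ℝ) r.2, g s := by
        gcongr with r hr
        exact (hF (huF hr)).2.le
    _ = 5 * ∫⁻ s in ⋃ r ∈ u, Set.Ioo (r.1 : ℝ) r.2, g s := by
        rw [lintegral_biUnion_finset hdisj fun _ _ => measurableSet_Ioo]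
    _ ≤ 5 * ∫⁻ s, g s := by
        gcongr
        exact Measure.restrict_le_self

theorem lintegral_div_le_truncation {X : Type*} [MeasurableSpace X] {μ : Measure X}
    {f : X → ℝ≥0∞} (t : ℝ≥0∞) {s : Set X} {m : ℝ≥0∞} (hm : μ s ≤ m) :
    (∫⁻ x in s, f x ∂μ) / m ≤
      (∫⁻ x in s, {x | t < 2 * f x}.indicator f x ∂μ) / m + t / 2 := by
  calc (∫⁻ x in s, f x ∂μ) / m
      ≤ (∫⁻ x in s, ({x | t < 2 * f x}.indicator f x + t / 2) ∂μ) / m := by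
        gcongr with x
        by_cases hx : t < 2 * f x
        · simp [hx]
        · simp only [Set.indicator, Set.mem_ofPred_eq, hx, if_false, zero_add]
          rw [ENNReal.le_div_iff_mul_le (by simp) (by simp), mul_comm]
          exact not_lt.1 hx
    _ = (∫⁻ x in s, {x | t < 2 * f x}.indicator f x ∂μ) / m + t / 2 * (μ s / m) := by
        rw [lintegral_add_right _ measurable_const, setLIntegral_const, ENNReal.add_div,
          mul_div_assoc]
    _ ≤ _ := by
        gcongr
        calc t / 2 * (μ s / m) ≤ t / 2 * 1 := by
              gcongr
              exact ENNReal.div_le_of_le_mul (by simpa using hm)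
          _ = t / 2 := mul_one _

theorem lineMaximal_le_truncation (g : ℝ → ℝ≥0∞) (t : ℝ≥0∞) (x : ℝ) :
    lineMaximal g x ≤ lineMaximal ({y | t < 2 * g y}.indicator g) x + t / 2 := by
  refine iSup₂_le fun r hr => (lintegral_div_le_truncation t ?_).trans ?_
  · rw [Real.volume_Ioo]
  · gcongr
    exact le_iSup₂_of_le r hr le_rfl

theorem exists_lintegral_lineMaximal_rpow_le {p : ℝ} (hp : 1 < p) :
    ∃ K : ℝ≥0∞, K ≠ ⊤ ∧ ∀ g : ℝ → ℝ≥0∞, Measurable g →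
      ∫⁻ x, lineMaximal g x ^ p ≤ K * ∫⁻ x, g x ^ p := by
  obtain ⟨K, hK, h⟩ := exists_lintegral_rpow_le_of_weak_type one_pos hp
    (A := 10) (by simp)
  refine ⟨K, hK, fun g hg => h _ _ g _ hg (measurable_lineMaximal g) fun t ht => ?_⟩
  simp only [ENNReal.rpow_one]
  rw [← lintegral_indicator (measurableSet_lt measurable_const (by fun_prop))]
  set T := ENNReal.ofReal t
  have hsub : {x | T < lineMaximal g x} ⊆
      {x | T / 2 < lineMaximal ({y | T < 2 * g y}.indicator g) x} := by
    intro x hx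
    by_contra hle
    have h1 := lineMaximal_le_truncation g T x
    have h2 : lineMaximal ({y | T < 2 * g y}.indicator g) x ≤ T / 2 := not_lt.1 hle
    have : lineMaximal g x ≤ T := (h1.trans (add_le_add_left h2 _)).trans (ENNReal.add_halves T).le
    exact absurd hx (not_lt.2 this)
  calc T * volume {x | T < lineMaximal g x}
      ≤ T * volume {x | T / 2 < lineMaximal ({y | T < 2 * g y}.indicator g) x} := by gcongr
    _ = 2 * (T / 2 * volume {x | T / 2 < lineMaximal ({y | T < 2 * g y}.indicator g) x}) := by
        rw [← mul_assoc, ENNReal.mul_div_cancel (by simp) (by simp)]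
    _ ≤ 2 * (5 * ∫⁻ s, {y | T < 2 * g y}.indicator g s) := by
        exact mul_le_mul_right (lineMaximal_weak_type _) 2
    _ = _ := by rw [← mul_assoc]; norm_num

/-- The one-dimensional maximal operator acting in the coordinate `i`. -/
noncomputable def coordMaximal {d : ℕ} (i : Fin d) (f : (Fin d → ℝ) → ℝ≥0∞) (x : Fin d → ℝ) :
    ℝ≥0∞ :=
  lineMaximal (fun s => f (Function.update x i s)) (x i)

theorem measurable_coordMaximal {d : ℕ} (i : Fin d) {f : (Fin d → ℝ) → ℝ≥0∞}
    (hf : Measurable f) : Measurable (coordMaximal i f) := by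
  refine Measurable.iSup fun r => ?_
  have : (fun x : Fin d → ℝ => ⨆ (_ : x i ∈ Set.Ioo (r.1 : ℝ) r.2),
      (∫⁻ s in Set.Ioo (r.1 : ℝ) r.2, f (Function.update x i s)) /
        ENNReal.ofReal (r.2 - r.1)) =
      ((fun x : Fin d → ℝ => x i) ⁻¹' Set.Ioo (r.1 : ℝ) r.2).indicator
        fun x => (∫⁻ s in Set.Ioo (r.1 : ℝ) r.2, f (Function.update x i s)) /
          ENNReal.ofReal (r.2 - r.1) := by
    ext x
    by_cases hx : x i ∈ Set.Ioo (r.1 : ℝ) r.2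
    · rw [iSup_pos hx, Set.indicator_of_mem (by exact hx)]
    · rw [iSup_neg hx, Set.indicator_of_notMem (by exact hx)]; rfl
  rw [this]
  refine Measurable.indicator ?_ (measurable_pi_apply i measurableSet_Ioo)
  refine Measurable.div_const ?_ _
  refine Measurable.lintegral_prod_right' (f := fun z : (Fin d → ℝ) × ℝ =>
    f (Function.update z.1 i z.2)) ?_
  exact hf.comp measurable_update'

theorem lintegral_coordMaximal_rpow_le {p : ℝ} {K : ℝ≥0∞} (hK : K ≠ ⊤)
    (h : ∀ g : ℝ → ℝ≥0∞, Measurable g → ∫⁻ x, lineMaximal g x ^ p ≤ K * ∫⁻ x, g x ^ p)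
    {d : ℕ} (i : Fin d) {f : (Fin d → ℝ) → ℝ≥0∞} (hf : Measurable f) :
    ∫⁻ x, coordMaximal i f x ^ p ≤ K * ∫⁻ x, f x ^ p := by
  have hF : Measurable fun x => coordMaximal i f x ^ p := (measurable_coordMaximal i hf).pow_const p
  have hfp : Measurable fun x => K * f x ^ p := (hf.pow_const p).const_mul K
  have hi : (Finset.univ : Finset (Fin d)) = insert i (Finset.univ.erase i) := by simp
  rw [← lintegral_const_mul' _ _ hK, volume_pi, lintegral_eq_lmarginal_univ (fun _ => 0),
    lintegral_eq_lmarginal_univ (fun _ => 0), hi, lmarginal_insert' _ hF (by simp),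
    lmarginal_insert' _ hfp (by simp)]
  refine lmarginal_mono (fun x => ?_) _
  simp only [coordMaximal, Function.update_idem, Function.update_self]
  rw [lintegral_const_mul' _ _ hK]
  exact h _ (hf.comp (measurable_update x))

/-- The composition of the coordinate maximal operators along a list of coordinates. -/
noncomputable def iterCoordMaximal {d : ℕ} (l : List (Fin d)) (f : (Fin d → ℝ) → ℝ≥0∞) :
    (Fin d → ℝ) → ℝ≥0∞ :=
  l.foldr coordMaximal f

theorem measurable_iterCoordMaximal {d : ℕ} (l : List (Fin d)) {f : (Fin d → ℝ) → ℝ≥0∞}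
    (hf : Measurable f) : Measurable (iterCoordMaximal l f) := by
  induction l with
  | nil => exact hf
  | cons i l ih => exact measurable_coordMaximal i ih

theorem lintegral_iterCoordMaximal_rpow_le {p : ℝ} {K : ℝ≥0∞} (hK : K ≠ ⊤)
    (h : ∀ g : ℝ → ℝ≥0∞, Measurable g → ∫⁻ x, lineMaximal g x ^ p ≤ K * ∫⁻ x, g x ^ p)
    {d : ℕ} (l : List (Fin d)) {f : (Fin d → ℝ) → ℝ≥0∞} (hf : Measurable f) :
    ∫⁻ x, iterCoordMaximal l f x ^ p ≤ K ^ l.length * ∫⁻ x, f x ^ p := by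
  induction l with
  | nil => simp [iterCoordMaximal]
  | cons i l ih =>
    refine (lintegral_coordMaximal_rpow_le hK h i (measurable_iterCoordMaximal l hf)).trans ?_
    rw [List.length_cons, pow_succ', mul_assoc]
    gcongr

theorem lmarginal_le_iterCoordMaximal {d : ℕ} {a b : Fin d → ℝ} {f : (Fin d → ℝ) → ℝ≥0∞}
    (hf : Measurable f) (l : List (Fin d)) (hl : l.Nodup) (x : Fin d → ℝ)
    (hx : ∀ i, x i ∈ Set.Ioo (a i) (b i)) :
    (∫⋯∫⁻_l.toFinset, f ∂fun i => volume.restrict (Set.Ioo (a i) (b i))) x ≤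
      (∏ i ∈ l.toFinset, 2 * ENNReal.ofReal (b i - a i)) * iterCoordMaximal l f x := by
  induction l generalizing x with
  | nil => simp [iterCoordMaximal]
  | cons i l ih =>
    obtain ⟨hil, hl⟩ := List.nodup_cons.1 hl
    have hil' : i ∉ l.toFinset := by simpa using hil
    rw [List.toFinset_cons, lmarginal_insert _ hf hil', Finset.prod_insert hil']
    set P := ∏ i ∈ l.toFinset, 2 * ENNReal.ofReal (b i - a i)
    have hPtop : P ≠ ⊤ := ENNReal.prod_ne_top fun i _ =>
      ENNReal.mul_ne_top (by simp) ENNReal.ofReal_ne_top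
    calc ∫⁻ s in Set.Ioo (a i) (b i),
          (∫⋯∫⁻_l.toFinset, f ∂fun i => volume.restrict (Set.Ioo (a i) (b i)))
            (Function.update x i s)
        ≤ ∫⁻ s in Set.Ioo (a i) (b i), P * iterCoordMaximal l f (Function.update x i s) := by
          refine setLIntegral_mono' measurableSet_Ioo fun s hs => ih hl _ fun j => ?_
          rcases eq_or_ne j i with rfl | hj
          · simpa using hs
          · simpa [hj] using hx j
      _ = P * ∫⁻ s in Set.Ioo (a i) (b i), iterCoordMaximal l f (Function.update x i s) :=
          lintegral_const_mul' _ _ hPtop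
      _ ≤ P * (2 * ENNReal.ofReal (b i - a i) * iterCoordMaximal (i :: l) f x) := by
          gcongr
          exact lintegral_Ioo_le_lineMaximal _ (hx i)
      _ = _ := by ring

/-- The open box with lower corner `r.1` and upper corner `r.2`. -/
def openBox {d : ℕ} (r : (Fin d → ℝ) × (Fin d → ℝ)) : Set (Fin d → ℝ) :=
  Set.univ.pi fun i => Set.Ioo (r.1 i) (r.2 i)

/-- Nondegenerate boxes whose side lengths take at most `c` values. -/
def HasComplexity {d : ℕ} (c : ℕ) (r : (Fin d → ℝ) × (Fin d → ℝ)) : Prop :=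
  (∀ i, r.1 i < r.2 i) ∧ (Finset.image (fun i => r.2 i - r.1 i) Finset.univ).card ≤ c

/-- The box with the same centre and three times the side lengths. -/
def tripleBox {d : ℕ} (r : (Fin d → ℝ) × (Fin d → ℝ)) : (Fin d → ℝ) × (Fin d → ℝ) :=
  (fun i => 2 * r.1 i - r.2 i, fun i => 2 * r.2 i - r.1 i)

/-- The variant of `strongMaximal` over open boxes, which is lower semicontinuous. -/
noncomputable def openMaximal {d : ℕ} (c : ℕ) (f : (Fin d → ℝ) → ℝ≥0∞) (x : Fin d → ℝ) : ℝ≥0∞ :=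
  ⨆ (r : (Fin d → ℝ) × (Fin d → ℝ)) (_ : HasComplexity c r) (_ : x ∈ openBox r),
    (∫⁻ y in openBox r, f y) / volume (openBox r)

/-- The variant of `iterMaximal` built from `openMaximal`. -/
noncomputable def iterOpenMaximal {d : ℕ} :
    ℕ → ((Fin d → ℝ) → ℝ≥0∞) → ((Fin d → ℝ) → ℝ≥0∞)
  | 0, g => g
  | c + 1, g => openMaximal (c + 1) (iterOpenMaximal c g)

section Boxes

variable {d c : ℕ} {r : (Fin d → ℝ) × (Fin d → ℝ)} {f g : (Fin d → ℝ) → ℝ≥0∞}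

theorem mem_openBox {x : Fin d → ℝ} : x ∈ openBox r ↔ ∀ i, r.1 i < x i ∧ x i < r.2 i := by
  simp [openBox]

theorem isOpen_openBox : IsOpen (openBox r) :=
  isOpen_set_pi Set.finite_univ fun _ _ => isOpen_Ioo

theorem measurableSet_openBox : MeasurableSet (openBox r) :=
  isOpen_openBox.measurableSet

theorem volume_openBox : volume (openBox r) = ∏ i, ENNReal.ofReal (r.2 i - r.1 i) :=
  Real.volume_pi_Ioo

theorem volume_openBox_ne_top : volume (openBox r) ≠ ⊤ := by
  rw [volume_openBox]
  exact ENNReal.prod_ne_top fun _ _ => ENNReal.ofReal_ne_top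

theorem HasComplexity.volume_ne_zero (hr : HasComplexity c r) : volume (openBox r) ≠ 0 := by
  rw [volume_openBox, Finset.prod_ne_zero_iff]
  intro i _
  simpa using hr.1 i

theorem HasComplexity.triple (hr : HasComplexity c r) : HasComplexity c (tripleBox r) := by
  refine ⟨fun i => ?_, le_trans ?_ hr.2⟩
  · have := hr.1 i
    simp only [tripleBox]; linarith
  · have : (Finset.image (fun i => (tripleBox r).2 i - (tripleBox r).1 i) Finset.univ) =
        (Finset.image (fun i => r.2 i - r.1 i) Finset.univ).image fun t => 3 * t := by
      rw [Finset.image_image]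
      congr 1
      ext i
      simp only [tripleBox, Function.comp_apply]; ring
    rw [this]
    exact Finset.card_image_le

theorem volume_tripleBox : volume (openBox (tripleBox r)) = 3 ^ d * volume (openBox r) := by
  have h : ∀ i, ENNReal.ofReal ((tripleBox r).2 i - (tripleBox r).1 i) =
      3 * ENNReal.ofReal (r.2 i - r.1 i) := fun i => by
    rw [show (3 : ℝ≥0∞) = ENNReal.ofReal 3 by norm_num, ← ENNReal.ofReal_mul (by norm_num)]
    simp only [tripleBox]; ring_nf
  simp only [volume_openBox, h, Finset.prod_mul_distrib, Finset.prod_const, Finset.card_univ,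
    Fintype.card_fin]

theorem HasComplexity.openBox_subset_triple (hr : HasComplexity c r) :
    openBox r ⊆ openBox (tripleBox r) := fun x hx => by
  rw [mem_openBox] at hx ⊢
  intro i
  have := hr.1 i
  have := hx i
  constructor <;> simp only [tripleBox] <;> linarith

theorem HasComplexity.average_le_openMaximal (hr : HasComplexity c r) {x : Fin d → ℝ}
    (hx : x ∈ openBox r) : (∫⁻ y in openBox r, f y) / volume (openBox r) ≤ openMaximal c f x :=
  le_iSup_of_le r (le_iSup₂_of_le hr hx le_rfl)

theorem setOf_lt_openMaximal (t : ℝ≥0∞) :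
    {x | t < openMaximal c f x} =
      ⋃ r ∈ {r : (Fin d → ℝ) × (Fin d → ℝ) | HasComplexity c r ∧
        t < (∫⁻ y in openBox r, f y) / volume (openBox r)}, openBox r := by
  ext x
  simp only [openMaximal, Set.mem_ofPred_eq, lt_iSup_iff, Set.mem_iUnion, exists_prop]
  constructor
  · rintro ⟨r, hr, hx, ht⟩
    exact ⟨r, ⟨hr, ht⟩, hx⟩
  · rintro ⟨r, ⟨hr, ht⟩, hx⟩
    exact ⟨r, hr, hx, ht⟩

theorem isOpen_setOf_lt_openMaximal (t : ℝ≥0∞) : IsOpen {x | t < openMaximal c f x} := by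
  rw [setOf_lt_openMaximal]
  exact isOpen_biUnion fun _ _ => isOpen_openBox

theorem measurable_openMaximal : Measurable (openMaximal c f) :=
  measurable_of_Ioi fun t => (isOpen_setOf_lt_openMaximal t).measurableSet

theorem openMaximal_mono (hfg : f ≤ g) : openMaximal c f ≤ openMaximal c g := fun _ =>
  iSup_mono fun _ => iSup₂_mono fun _ _ =>
    ENNReal.div_le_div_right (lintegral_mono fun y => hfg y) _

theorem openMaximal_congr_ae (hfg : f =ᵐ[volume] g) : openMaximal c f = openMaximal c g := by
  ext x
  simp only [openMaximal]
  exact iSup_congr fun r => iSup_congr fun _ => iSup_congr fun _ => by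
    rw [lintegral_congr_ae (ae_restrict_of_ae hfg)]

theorem iterOpenMaximal_congr_ae (hfg : f =ᵐ[volume] g) :
    iterOpenMaximal (c + 1) f = iterOpenMaximal (c + 1) g := by
  induction c with
  | zero => exact openMaximal_congr_ae hfg
  | succ c ih => exact congrArg (openMaximal (c + 2)) ih

theorem volume_Icc_eq_volume_openBox : volume (Set.Icc r.1 r.2) = volume (openBox r) := by
  rw [Real.volume_Icc_pi, volume_openBox]

theorem openMaximal_le_strongMaximal : openMaximal c f ≤ strongMaximal d c f := fun x => by
  refine iSup_le fun r => iSup₂_le fun hr hx => ?_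
  have hsub : openBox r ⊆ Set.Icc r.1 r.2 := fun y hy =>
    ⟨fun i => ((mem_openBox.1 hy) i).1.le, fun i => ((mem_openBox.1 hy) i).2.le⟩
  calc (∫⁻ y in openBox r, f y) / volume (openBox r)
      ≤ (∫⁻ y in Set.Icc r.1 r.2, f y) / volume (Set.Icc r.1 r.2) := by
        rw [volume_Icc_eq_volume_openBox]
        exact ENNReal.div_le_div_right (lintegral_mono_set hsub) _
    _ ≤ _ := by
        unfold strongMaximal
        exact le_iSup₂_of_le r.1 r.2 (le_iSup₂_of_le hr.1 hr.2 (le_iSup_of_le (hsub hx) le_rfl))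

theorem strongMaximal_le_openMaximal (x : Fin d → ℝ) :
    strongMaximal d c f x ≤ 3 ^ d * openMaximal c f x := by
  refine iSup₂_le fun a b => iSup_le fun hab => iSup_le fun hcard => iSup_le fun hx => ?_
  have hr : HasComplexity c (a, b) := ⟨hab, hcard⟩
  have hsub : Set.Icc a b ⊆ openBox (tripleBox (a, b)) := fun y hy => mem_openBox.2 fun i => by
    have h1 := hy.1 i
    have h2 := hy.2 i
    have h3 := hab i
    constructor <;> simp only [tripleBox] <;> linarith
  have h3 : (3 : ℝ≥0∞) ^ d ≠ 0 := by simp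
  have h3' : (3 : ℝ≥0∞) ^ d ≠ ⊤ := by simp
  calc (∫⁻ y in Set.Icc a b, f y) / volume (Set.Icc a b)
      ≤ (∫⁻ y in openBox (tripleBox (a, b)), f y) / volume (openBox (a, b)) := by
        rw [← volume_Icc_eq_volume_openBox]
        exact ENNReal.div_le_div_right (lintegral_mono_set hsub) _
    _ = 3 ^ d * ((∫⁻ y in openBox (tripleBox (a, b)), f y) /
          volume (openBox (tripleBox (a, b)))) := by
        rw [volume_tripleBox, div_eq_mul_inv, div_eq_mul_inv,
          ENNReal.mul_inv (Or.inl h3) (Or.inl h3'), mul_left_comm, ← mul_assoc (3 ^ d),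
          ENNReal.mul_inv_cancel h3 h3', one_mul]
    _ ≤ _ := by
        gcongr
        exact hr.triple.average_le_openMaximal (hsub hx)

theorem iterOpenMaximal_le_iterMaximal : iterOpenMaximal c f ≤ iterMaximal d c f := by
  induction c with
  | zero => exact le_rfl
  | succ c ih => exact (openMaximal_mono ih).trans openMaximal_le_strongMaximal

theorem openMaximal_zero (hd : 1 ≤ d) (x : Fin d → ℝ) : openMaximal 0 f x = 0 := by
  refine nonpos_iff_eq_zero.1 (iSup_le fun r => iSup_le fun hr => ?_)
  have h := Finset.image_eq_empty.1 (Finset.card_eq_zero.1 (Nat.le_zero.1 hr.2))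
  have : (⟨0, hd⟩ : Fin d) ∈ (Finset.univ : Finset (Fin d)) := Finset.mem_univ _
  simp [h] at this

theorem openMaximal_le_truncation (t : ℝ≥0∞) (x : Fin d → ℝ) :
    openMaximal c f x ≤ openMaximal c ({y | t < 2 * f y}.indicator f) x + t / 2 := by
  refine iSup_le fun r => iSup₂_le fun hr hx => (lintegral_div_le_truncation t le_rfl).trans ?_
  gcongr
  exact hr.average_le_openMaximal hx

theorem openMaximal_le_iterCoordMaximal (hf : Measurable f) (x : Fin d → ℝ) :
    openMaximal c f x ≤ 2 ^ d * iterCoordMaximal (List.finRange d) f x := by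
  refine iSup_le fun r => iSup₂_le fun hr hx => ?_
  have h := lmarginal_le_iterCoordMaximal hf (List.finRange d) (List.nodup_finRange d) x
    (mem_openBox.1 hx)
  rw [List.toFinset_finRange, ← lintegral_eq_lmarginal_univ x,
    ← Measure.restrict_pi_pi, ← volume_pi, Finset.prod_mul_distrib, ← volume_openBox,
    Finset.prod_const, Finset.card_univ, Fintype.card_fin] at h
  rw [ENNReal.div_le_iff hr.volume_ne_zero volume_openBox_ne_top]
  exact h.trans_eq (by ring)

theorem exists_lintegral_openMaximal_rpow_le (d : ℕ) {p : ℝ} (hp : 1 < p) :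
    ∃ K : ℝ≥0∞, K ≠ ⊤ ∧ ∀ (c : ℕ) (f : (Fin d → ℝ) → ℝ≥0∞), Measurable f →
      ∫⁻ x, openMaximal c f x ^ p ≤ K * ∫⁻ x, f x ^ p := by
  obtain ⟨K, hK, h⟩ := exists_lintegral_lineMaximal_rpow_le hp
  have hp0 : 0 ≤ p := zero_le_one.trans hp.le
  have h2 : ((2 : ℝ≥0∞) ^ d) ^ p ≠ ⊤ := ENNReal.rpow_ne_top_of_nonneg hp0 (by simp)
  refine ⟨(2 ^ d) ^ p * K ^ d, ENNReal.mul_ne_top h2 (ENNReal.pow_ne_top hK), fun c f hf => ?_⟩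
  calc ∫⁻ x, openMaximal c f x ^ p
      ≤ ∫⁻ x, (2 ^ d) ^ p * iterCoordMaximal (List.finRange d) f x ^ p := by
        gcongr with x
        rw [← ENNReal.mul_rpow_of_nonneg _ _ hp0]
        exact ENNReal.rpow_le_rpow (openMaximal_le_iterCoordMaximal hf x) hp0
    _ = (2 ^ d) ^ p * ∫⁻ x, iterCoordMaximal (List.finRange d) f x ^ p :=
        lintegral_const_mul' _ _ h2
    _ ≤ (2 ^ d) ^ p * (K ^ d * ∫⁻ x, f x ^ p) := by
        gcongr
        simpa using lintegral_iterCoordMaximal_rpow_le hK h (List.finRange d) hf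
    _ = _ := (mul_assoc _ _ _).symm

theorem volume_image_affine_diagonal {v D : Fin d → ℝ} (hD : ∀ i, 0 < D i) (s : Set (Fin d → ℝ)) :
    volume ((fun y i => v i + D i * y i) '' s) = ENNReal.ofReal (∏ i, D i) * volume s := by
  have h : (fun (y : Fin d → ℝ) i => v i + D i * y i) '' s =
      (fun y => v + y) '' (Matrix.toLin' (Matrix.diagonal D) '' s) := by
    rw [Set.image_image]
    refine Set.image_congr fun y _ => ?_
    ext i
    simp [Matrix.mulVec_diagonal]
  rw [h, Set.image_add_left, measure_preimage_add, Measure.addHaar_image_linearMap,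
    LinearMap.det_toLin', Matrix.det_diagonal, abs_of_pos (Finset.prod_pos fun i _ => hD i)]

/-- The set `E` together with the points where the maximal function of its indicator is large. -/
def halo (c : ℕ) (E : Set (Fin d → ℝ)) : Set (Fin d → ℝ) :=
  E ∪ {x | 1 / 2 < openMaximal c (E.indicator fun _ => 1) x}

theorem halo_mono {E F : Set (Fin d → ℝ)} (h : E ⊆ F) : halo c E ⊆ halo c F :=
  Set.union_subset_union h fun x hx => by
    have hx : 1 / 2 < openMaximal c (E.indicator fun _ => 1) x := hx
    exact hx.trans_le (openMaximal_mono (Set.indicator_le_indicator_of_subset h (by simp)) x)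

/-- `B` is the set of the coordinates in which the box `r` is longest. -/
def IsLongSides (B : Finset (Fin d)) (r : (Fin d → ℝ) × (Fin d → ℝ)) : Prop :=
  ∀ i ∈ B, ∀ j, r.2 j - r.1 j ≤ r.2 i - r.1 i ∧ (j ∉ B → r.2 j - r.1 j < r.2 i - r.1 i)

theorem exists_isLongSides (hd : 1 ≤ d) (r : (Fin d → ℝ) × (Fin d → ℝ)) :
    ∃ B : Finset (Fin d), B.Nonempty ∧ IsLongSides B r := by
  classical
  obtain ⟨i, -, hi⟩ := Finset.exists_max_image Finset.univ (fun i => r.2 i - r.1 i)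
    ⟨(⟨0, hd⟩ : Fin d), Finset.mem_univ _⟩
  refine ⟨Finset.univ.filter fun j => r.2 j - r.1 j = r.2 i - r.1 i, ⟨i, by simp⟩,
    fun k hk j => ?_⟩
  have hk : r.2 k - r.1 k = r.2 i - r.1 i := by simpa using hk
  have hj := hi j (Finset.mem_univ _)
  refine ⟨hj.trans_eq hk.symm, fun hjB => ?_⟩
  rw [hk]
  exact lt_of_le_of_ne hj (by simpa using hjB)

/-- If at least half of a box `r` is covered by boxes that are longer in the coordinates where `r`
is longest, then `r` is contained in the halo, of smaller complexity, of the enlarged boxes. -/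
theorem HasComplexity.openBox_subset_halo (hr : HasComplexity (c + 1) r) {B : Finset (Fin d)}
    (hB : IsLongSides B r) (hne : B.Nonempty) {G : Finset ((Fin d → ℝ) × (Fin d → ℝ))}
    (hGpos : ∀ k ∈ G, ∀ i, k.1 i < k.2 i)
    (hG : ∀ k ∈ G, ∀ i ∈ B, r.2 i - r.1 i ≤ k.2 i - k.1 i)
    (hvol : volume (openBox r) < 2 * volume (openBox r ∩ ⋃ k ∈ G, openBox k)) :
    openBox r ⊆ halo c (⋃ k ∈ G, openBox (tripleBox k)) := by
  classical
  intro x hx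
  have hx' := mem_openBox.1 hx
  by_cases huniv : B = Finset.univ
  · have hpos : volume (openBox r ∩ ⋃ k ∈ G, openBox k) ≠ 0 := by
      intro h0; simp [h0] at hvol
    obtain ⟨y, hyr, hy⟩ := nonempty_of_measure_ne_zero hpos
    obtain ⟨k, hk, hyk⟩ := Set.mem_iUnion₂.1 hy
    refine Or.inl (Set.mem_iUnion₂.2 ⟨k, hk, mem_openBox.2 fun i => ?_⟩)
    have h1 := hx' i
    have h2 := mem_openBox.1 hyr i
    have h3 := mem_openBox.1 hyk i
    have h4 := hG k hk i (by simp [huniv])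
    constructor <;> simp only [tripleBox] <;> linarith
  obtain ⟨i₀, hi₀⟩ := hne
  have hcompl : (Bᶜ : Finset (Fin d)).Nonempty := by
    rw [Finset.nonempty_iff_ne_empty]
    intro h
    exact huniv (by simpa using h)
  obtain ⟨j₀, hj₀, hmax⟩ := Finset.exists_max_image Bᶜ (fun i => r.2 i - r.1 i) hcompl
  have hj₀B : j₀ ∉ B := by simpa using hj₀
  set L := r.2 i₀ - r.1 i₀
  set l := r.2 j₀ - r.1 j₀
  have hlpos : 0 < l := sub_pos.2 (hr.1 j₀)
  have hlL : l < L := (hB i₀ hi₀ j₀).2 hj₀B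
  have hLpos : 0 < L := hlpos.trans hlL
  have hside : ∀ i ∈ B, r.2 i - r.1 i = L := fun i hi =>
    le_antisymm (hB i₀ hi₀ i).1 (hB i hi i₀).1
  set D : Fin d → ℝ := fun i => if i ∈ B then l / L else 1 with hD
  have hDpos : ∀ i, 0 < D i := fun i => by
    by_cases hi : i ∈ B <;> simp only [hD, hi, if_true, if_false] <;> positivity
  have hDle : ∀ i, D i ≤ 1 := fun i => by
    by_cases hi : i ∈ B <;> simp only [hD, hi, if_true, if_false, le_refl]
    exact (div_le_one hLpos).2 hlL.le
  set v : Fin d → ℝ := fun i => (1 - D i) * x i with hv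
  set φ : (Fin d → ℝ) → Fin d → ℝ := fun y i => v i + D i * y i with hφ
  set r' : (Fin d → ℝ) × (Fin d → ℝ) := (φ r.1, φ r.2) with hr'
  have hsides' : ∀ i, r'.2 i - r'.1 i = D i * (r.2 i - r.1 i) := fun i => by
    simp only [hr', hφ]; ring
  have hcomp : HasComplexity c r' := by
    refine ⟨fun i => ?_, ?_⟩
    · have := mul_pos (hDpos i) (sub_pos.2 (hr.1 i))
      have := hsides' i
      linarith
    · have hsub : Finset.image (fun i => r'.2 i - r'.1 i) Finset.univ ⊆
          (Finset.image (fun i => r.2 i - r.1 i) Finset.univ).erase L := by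
        intro s hs
        obtain ⟨i, -, rfl⟩ := Finset.mem_image.1 hs
        simp only [hsides']
        by_cases hi : i ∈ B
        · have h1 : D i * (r.2 i - r.1 i) = l := by
            rw [hside i hi]; simp only [hD, hi, if_true]; field_simp
          rw [h1]
          exact Finset.mem_erase.2 ⟨hlL.ne, Finset.mem_image_of_mem _ (Finset.mem_univ j₀)⟩
        · have h1 : D i * (r.2 i - r.1 i) = r.2 i - r.1 i := by
            simp only [hD, hi, if_false, one_mul]
          rw [h1]
          exact Finset.mem_erase.2 ⟨((hB i₀ hi₀ i).2 hi).ne,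
            Finset.mem_image_of_mem (fun i => r.2 i - r.1 i) (Finset.mem_univ i)⟩
      have h2 := Finset.card_le_card hsub
      rw [Finset.card_erase_of_mem
        (Finset.mem_image_of_mem (fun i => r.2 i - r.1 i) (Finset.mem_univ i₀))] at h2
      have := hr.2
      omega
  have hφmem : ∀ y ∈ openBox r, φ y ∈ openBox r' := fun y hy => mem_openBox.2 fun i => by
    have := mem_openBox.1 hy i
    have := hDpos i
    constructor <;> simp only [hr', hφ] <;> nlinarith
  have hφmem' : ∀ y ∈ openBox r, φ y ∈ openBox r := fun y hy => mem_openBox.2 fun i => by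
    have h1 := mem_openBox.1 hy i
    have h2 := hx' i
    have h3 := hDpos i
    have h4 := hDle i
    constructor <;> simp only [hφ, hv] <;> nlinarith
  have hxr' : x ∈ openBox r' := by
    have : φ x = x := by ext i; simp only [hφ, hv]; ring
    simpa [this] using hφmem x hx
  have himage : φ '' (openBox r ∩ ⋃ k ∈ G, openBox k) ⊆
      openBox r' ∩ ⋃ k ∈ G, openBox (tripleBox k) := by
    rintro _ ⟨y, ⟨hyr, hy⟩, rfl⟩
    obtain ⟨k, hk, hyk⟩ := Set.mem_iUnion₂.1 hy
    refine ⟨hφmem y hyr, Set.mem_iUnion₂.2 ⟨k, hk, mem_openBox.2 fun i => ?_⟩⟩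
    have h1 := mem_openBox.1 (hφmem' y hyr) i
    have h2 := mem_openBox.1 hyr i
    have h3 := mem_openBox.1 hyk i
    have h5 := hGpos k hk i
    by_cases hi : i ∈ B
    · have h4 := hG k hk i hi
      constructor <;> simp only [tripleBox] <;> linarith
    · have : φ y i = y i := by simp [hφ, hv, hD, hi]
      rw [this]
      constructor <;> simp only [tripleBox] <;> linarith
  have hδ0 : ENNReal.ofReal (∏ i, D i) ≠ 0 := by
    simpa using Finset.prod_pos fun i _ => hDpos i
  have hvol' : volume (openBox r') = ENNReal.ofReal (∏ i, D i) * volume (openBox r) := by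
    rw [volume_openBox, volume_openBox, ENNReal.ofReal_prod_of_nonneg fun i _ => (hDpos i).le,
      ← Finset.prod_mul_distrib]
    exact Finset.prod_congr rfl fun i _ => by rw [hsides', ENNReal.ofReal_mul (hDpos i).le]
  have hmeas : MeasurableSet (⋃ k ∈ G, openBox (tripleBox k)) :=
    Finset.measurableSet_biUnion _ fun _ _ => measurableSet_openBox
  have hlarge : volume (openBox r') <
      2 * volume (openBox r' ∩ ⋃ k ∈ G, openBox (tripleBox k)) := by
    calc volume (openBox r')
        < ENNReal.ofReal (∏ i, D i) * (2 * volume (openBox r ∩ ⋃ k ∈ G, openBox k)) := by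
          rw [hvol']
          exact ENNReal.mul_lt_mul_right hδ0 ENNReal.ofReal_ne_top hvol
      _ = 2 * volume (φ '' (openBox r ∩ ⋃ k ∈ G, openBox k)) := by
          rw [hφ, volume_image_affine_diagonal hDpos]; ring
      _ ≤ _ := by gcongr
  refine Or.inr (lt_of_lt_of_le ?_ (hcomp.average_le_openMaximal hxr'))
  rw [lintegral_indicator hmeas, setLIntegral_one, Measure.restrict_apply hmeas, Set.inter_comm,
    ENNReal.lt_div_iff_mul_lt (Or.inl hcomp.volume_ne_zero) (Or.inl volume_openBox_ne_top)]
  rw [mul_comm, mul_one_div]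
  exact ENNReal.div_lt_of_lt_mul' hlarge

/-- A covering lemma of Córdoba–Fefferman type. -/
theorem exists_sparse_subfamily_halo {B : Finset (Fin d)} (hne : B.Nonempty)
    (F : Finset ((Fin d → ℝ) × (Fin d → ℝ)))
    (hF : ∀ r ∈ F, HasComplexity (c + 1) r ∧ IsLongSides B r) :
    ∃ G ⊆ F, ∃ E : (Fin d → ℝ) × (Fin d → ℝ) → Set (Fin d → ℝ),
      (∀ k ∈ G, MeasurableSet (E k) ∧ E k ⊆ openBox k ∧
        volume (openBox k) ≤ 2 * volume (E k)) ∧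
      (G : Set ((Fin d → ℝ) × (Fin d → ℝ))).PairwiseDisjoint E ∧
      ⋃ r ∈ F, openBox r ⊆ halo c (⋃ k ∈ G, openBox (tripleBox k)) := by
  classical
  obtain ⟨i₀, hi₀⟩ := id hne
  induction F using Finset.induction_on_min_value
    fun r : (Fin d → ℝ) × (Fin d → ℝ) => r.2 i₀ - r.1 i₀ with
  | empty => exact ⟨∅, by simp, fun _ => ∅, by simp, by simp, by simp⟩
  | insert r s hrs hmin ih =>
    obtain ⟨G, hGs, E, hE, hdisj, hcov⟩ := ih fun k hk => hF k (Finset.mem_insert_of_mem hk)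
    obtain ⟨hr, hrB⟩ := hF r (Finset.mem_insert_self _ _)
    by_cases hvol : volume (openBox r) < 2 * volume (openBox r ∩ ⋃ k ∈ G, openBox k)
    · refine ⟨G, hGs.trans (Finset.subset_insert _ _), E, hE, hdisj, ?_⟩
      rw [Finset.set_biUnion_insert]
      refine Set.union_subset (hr.openBox_subset_halo hrB hne
        (fun k hk => (hF k (Finset.mem_insert_of_mem (hGs hk))).1.1) (fun k hk i hi => ?_) hvol)
        hcov
      have h1 := (hrB i₀ hi₀ i).1
      have h2 := ((hF k (Finset.mem_insert_of_mem (hGs hk))).2 i hi i₀).1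
      exact h1.trans ((hmin k (hGs hk)).trans h2)
    · have hrG : r ∉ G := fun h => hrs (hGs h)
      have hEne : ∀ k ∈ G, Function.update E r (openBox r \ ⋃ k ∈ G, openBox k) k = E k :=
        fun k hk => Function.update_of_ne (ne_of_mem_of_not_mem hk hrG) _ _
      have hU : MeasurableSet (⋃ k ∈ G, openBox k) :=
        Finset.measurableSet_biUnion _ fun _ _ => measurableSet_openBox
      refine ⟨insert r G, Finset.insert_subset_insert _ hGs,
        Function.update E r (openBox r \ ⋃ k ∈ G, openBox k), ?_, ?_, ?_⟩
      · intro k hk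
        rcases Finset.mem_insert.1 hk with rfl | hk
        · rw [Function.update_self]
          refine ⟨measurableSet_openBox.diff hU, Set.sdiff_subset, ?_⟩
          have h1 := measure_inter_add_sdiff (μ := volume) (openBox k) hU
          have h2 := not_lt.1 hvol
          have h3 : volume (openBox k) + volume (openBox k) ≤
              volume (openBox k) + 2 * volume (openBox k \ ⋃ k ∈ G, openBox k) := by
            calc volume (openBox k) + volume (openBox k)
                = 2 * volume (openBox k ∩ ⋃ k ∈ G, openBox k) +
                  2 * volume (openBox k \ ⋃ k ∈ G, openBox k) := by
                  rw [← mul_add, h1, two_mul]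
              _ ≤ _ := by gcongr
          exact (ENNReal.add_le_add_iff_left volume_openBox_ne_top).1 h3
        · rw [hEne k hk]
          exact hE k hk
      · rw [Finset.coe_insert]
        refine Set.PairwiseDisjoint.insert (fun k hk k' hk' hkk' => ?_) fun k hk _ => ?_
        · simp only [Function.onFun, hEne k hk, hEne k' hk']
          exact hdisj hk hk' hkk'
        · rw [Function.update_self, hEne k hk]
          exact disjoint_sdiff_self_left.mono_right
            ((hE k hk).2.1.trans (Set.subset_biUnion_of_mem (u := openBox) hk))
      · rw [Finset.set_biUnion_insert, Finset.set_biUnion_insert]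
        refine Set.union_subset ?_ (hcov.trans (halo_mono Set.subset_union_right))
        exact hr.openBox_subset_triple.trans (Set.subset_union_left.trans Set.subset_union_left)

end Boxes

theorem setLIntegral_biUnion_finset_le {α β : Type*} [MeasurableSpace α] {μ : Measure α}
    (s : Finset β) (t : β → Set α) (f : α → ℝ≥0∞) :
    ∫⁻ x in ⋃ i ∈ s, t i, f x ∂μ ≤ ∑ i ∈ s, ∫⁻ x in t i, f x ∂μ := by
  classical
  induction s using Finset.induction_on with
  | empty => simp
  | insert a s ha ih =>
    rw [Finset.set_biUnion_insert, Finset.sum_insert ha]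
    exact (lintegral_union_le _ _ _).trans (by gcongr)

section WeakType

variable {d c : ℕ}

theorem rpow_mul_lintegral_tripleBox_le {q : ℝ} (hq : 0 < q) {f u : (Fin d → ℝ) → ℝ≥0∞}
    {r : (Fin d → ℝ) × (Fin d → ℝ)} (hr : HasComplexity c r) {E : Set (Fin d → ℝ)}
    (hE : MeasurableSet E) (hEr : E ⊆ openBox r) (hvol : volume (openBox r) ≤ 2 * volume E)
    (hf : Measurable f) {t : ℝ≥0∞} (ht : t < (∫⁻ y in openBox r, f y) / volume (openBox r)) :
    t ^ q * ∫⁻ y in openBox (tripleBox r), u y ≤ 3 ^ d * 2 *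
      ∫⁻ x in E, openMaximal c (fun y => f y * openMaximal c u y ^ q⁻¹) x ^ q := by
  set m := (∫⁻ y in openBox (tripleBox r), u y) / volume (openBox (tripleBox r)) with hm
  set N := openMaximal c fun y => f y * openMaximal c u y ^ q⁻¹
  have hmU : ∀ y ∈ openBox r, m ≤ openMaximal c u y := fun y hy =>
    hr.triple.average_le_openMaximal (hr.openBox_subset_triple hy)
  have h1 : ∀ x ∈ openBox r, t ^ q * m ≤ N x ^ q := fun x hx => by
    have hmq : (m ^ q⁻¹) ^ q = m := by rw [← ENNReal.rpow_mul, inv_mul_cancel₀ hq.ne',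
      ENNReal.rpow_one]
    calc t ^ q * m = (t * m ^ q⁻¹) ^ q := by rw [ENNReal.mul_rpow_of_nonneg _ _ hq.le, hmq]
      _ ≤ ((∫⁻ y in openBox r, f y) / volume (openBox r) * m ^ q⁻¹) ^ q := by gcongr
      _ = ((∫⁻ y in openBox r, f y * m ^ q⁻¹) / volume (openBox r)) ^ q := by
          rw [lintegral_mul_const _ hf, div_eq_mul_inv, div_eq_mul_inv, mul_right_comm]
      _ ≤ ((∫⁻ y in openBox r, f y * openMaximal c u y ^ q⁻¹) / volume (openBox r)) ^ q := by
          refine ENNReal.rpow_le_rpow (ENNReal.div_le_div_right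
            (setLIntegral_mono' measurableSet_openBox fun y hy => ?_) _) hq.le
          gcongr
          exact hmU y hy
      _ ≤ N x ^ q := by
          gcongr
          exact hr.average_le_openMaximal hx
  calc t ^ q * ∫⁻ y in openBox (tripleBox r), u y
      = t ^ q * (volume (openBox (tripleBox r)) * m) := by
        rw [hm, ENNReal.mul_div_cancel hr.triple.volume_ne_zero volume_openBox_ne_top]
    _ = 3 ^ d * volume (openBox r) * (t ^ q * m) := by rw [volume_tripleBox]; ring
    _ ≤ 3 ^ d * (2 * volume E) * (t ^ q * m) := by gcongr
    _ = 3 ^ d * 2 * ∫⁻ _ in E, t ^ q * m := by rw [setLIntegral_const]; ring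
    _ ≤ _ := by
        gcongr 1
        exact setLIntegral_mono' hE fun x hx => h1 x (hEr hx)

theorem openMaximal_weak_type_of_halo (hd : 1 ≤ d) {q : ℝ} (hq : 0 < q) {H K : ℝ≥0∞}
    (hH : ∀ w : (Fin d → ℝ) → ℝ≥0∞, Measurable w → ∀ E : Set (Fin d → ℝ), IsOpen E →
      ∫⁻ x in halo c E, w x ≤ H * ∫⁻ x in E, iterOpenMaximal c w x)
    (hK : ∀ f : (Fin d → ℝ) → ℝ≥0∞, Measurable f →
      ∫⁻ x, openMaximal (c + 1) f x ^ q ≤ K * ∫⁻ x, f x ^ q)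
    {w f : (Fin d → ℝ) → ℝ≥0∞} (hw : Measurable w) (hf : Measurable f) {t : ℝ≥0∞}
    (ht0 : t ≠ 0) (ht : t ≠ ⊤) :
    t ^ q * ∫⁻ x in {x | t < openMaximal (c + 1) f x}, w x ≤
      2 ^ d * (H * (3 ^ d * 2 * K)) * ∫⁻ x, f x ^ q * iterOpenMaximal (c + 1) w x := by
  classical
  have htq0 : t ^ q ≠ 0 := (ENNReal.rpow_pos (pos_iff_ne_zero.2 ht0) ht).ne'
  have htq : t ^ q ≠ ⊤ := ENNReal.rpow_ne_top_of_nonneg hq.le ht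
  set I := ∫⁻ x, f x ^ q * iterOpenMaximal (c + 1) w x with hI
  set u := iterOpenMaximal c w
  set S : Finset (Fin d) → Set ((Fin d → ℝ) × (Fin d → ℝ)) := fun B =>
    {r | (HasComplexity (c + 1) r ∧
      t < (∫⁻ y in openBox r, f y) / volume (openBox r)) ∧ IsLongSides B r}
  have hfinite : ∀ B : Finset (Fin d), B.Nonempty → ∀ F : Finset ((Fin d → ℝ) × (Fin d → ℝ)),
      (F : Set ((Fin d → ℝ) × (Fin d → ℝ))) ⊆ S B →
      t ^ q * ∫⁻ x in ⋃ r ∈ F, openBox r, w x ≤ H * (3 ^ d * 2 * K) * I := by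
    intro B hB F hF
    obtain ⟨G, hGF, E, hE, hdisj, hcov⟩ := exists_sparse_subfamily_halo hB F
      fun r hr => ⟨(hF hr).1.1, (hF hr).2⟩
    set N := openMaximal (c + 1) fun y => f y * openMaximal (c + 1) u y ^ q⁻¹
    calc t ^ q * ∫⁻ x in ⋃ r ∈ F, openBox r, w x
        ≤ t ^ q * (H * ∫⁻ x in ⋃ k ∈ G, openBox (tripleBox k), u x) := by
          gcongr 1
          exact (lintegral_mono_set hcov).trans
            (hH w hw _ (isOpen_biUnion fun _ _ => isOpen_openBox))
      _ ≤ t ^ q * (H * ∑ k ∈ G, ∫⁻ x in openBox (tripleBox k), u x) := by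
          gcongr 2
          exact setLIntegral_biUnion_finset_le _ _ _
      _ = H * ∑ k ∈ G, t ^ q * ∫⁻ x in openBox (tripleBox k), u x := by
          rw [mul_left_comm, Finset.mul_sum]
      _ ≤ H * ∑ k ∈ G, 3 ^ d * 2 * ∫⁻ x in E k, N x ^ q := by
          gcongr 2 with k hk
          obtain ⟨h1, h2, h3⟩ := hE k hk
          exact rpow_mul_lintegral_tripleBox_le hq (hF (hGF hk)).1.1 h1 h2 h3 hf (hF (hGF hk)).1.2
      _ = H * (3 ^ d * 2 * ∫⁻ x in ⋃ k ∈ G, E k, N x ^ q) := by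
          rw [← Finset.mul_sum, lintegral_biUnion_finset hdisj fun k hk => (hE k hk).1]
      _ ≤ H * (3 ^ d * 2 * ∫⁻ x, N x ^ q) := by
          gcongr 2
          exact setLIntegral_le_lintegral _ _
      _ ≤ H * (3 ^ d * 2 * (K * ∫⁻ x, (f x * openMaximal (c + 1) u x ^ q⁻¹) ^ q)) := by
          gcongr 2
          exact hK _ (hf.mul (measurable_openMaximal.pow_const _))
      _ = H * (3 ^ d * 2 * (K * I)) := by
          rw [hI]
          congr! 5 with x
          rw [ENNReal.mul_rpow_of_nonneg _ _ hq.le, ← ENNReal.rpow_mul, inv_mul_cancel₀ hq.ne',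
            ENNReal.rpow_one]
          rfl
      _ = _ := by ring
  have hcover : {x | t < openMaximal (c + 1) f x} ⊆
      ⋃ B ∈ (Finset.univ : Finset (Finset (Fin d))).filter Finset.Nonempty,
        ⋃ r ∈ S B, openBox r := by
    rw [setOf_lt_openMaximal]
    refine Set.iUnion₂_subset fun r hr x hx => ?_
    obtain ⟨B, hB, hBr⟩ := exists_isLongSides hd r
    exact Set.mem_iUnion₂.2 ⟨B, by simpa using hB, Set.mem_iUnion₂.2 ⟨r, ⟨hr, hBr⟩, hx⟩⟩
  have hB : ∀ B ∈ (Finset.univ : Finset (Finset (Fin d))).filter Finset.Nonempty,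
      t ^ q * ∫⁻ x in ⋃ r ∈ S B, openBox r, w x ≤ H * (3 ^ d * 2 * K) * I := by
    intro B hB
    have hopen : IsOpen (⋃ r ∈ S B, openBox r) := isOpen_biUnion fun _ _ => isOpen_openBox
    rw [mul_comm, ← ENNReal.le_div_iff_mul_le (Or.inl htq0) (Or.inl htq),
      ← withDensity_apply _ hopen.measurableSet]
    refine measure_biUnion_le_of_forall_finset_of_isOpen (fun _ _ => isOpen_openBox)
      fun F hF => ?_
    rw [ENNReal.le_div_iff_mul_le (Or.inl htq0) (Or.inl htq), mul_comm,
      withDensity_apply _ (Finset.measurableSet_biUnion _ fun _ _ => measurableSet_openBox)]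
    exact hfinite B (by simpa using hB) F hF
  calc t ^ q * ∫⁻ x in {x | t < openMaximal (c + 1) f x}, w x
      ≤ t ^ q * ∑ B ∈ (Finset.univ : Finset (Finset (Fin d))).filter Finset.Nonempty,
          ∫⁻ x in ⋃ r ∈ S B, openBox r, w x := by
        gcongr 1
        exact (lintegral_mono_set hcover).trans (setLIntegral_biUnion_finset_le _ _ _)
    _ = ∑ B ∈ (Finset.univ : Finset (Finset (Fin d))).filter Finset.Nonempty,
          t ^ q * ∫⁻ x in ⋃ r ∈ S B, openBox r, w x := Finset.mul_sum _ _ _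
    _ ≤ ∑ B ∈ (Finset.univ : Finset (Finset (Fin d))).filter Finset.Nonempty,
          H * (3 ^ d * 2 * K) * I := Finset.sum_le_sum hB
    _ ≤ ∑ B : Finset (Fin d), H * (3 ^ d * 2 * K) * I :=
        Finset.sum_le_sum_of_subset (Finset.filter_subset _ _)
    _ = _ := by
        rw [Finset.sum_const, Finset.card_univ, Fintype.card_finset, Fintype.card_fin,
          nsmul_eq_mul]
        push_cast; ring

theorem subset_setOf_lt_openMaximal_indicator {E : Set (Fin d → ℝ)} (hE : IsOpen E) :
    E ⊆ {x | 1 / 2 < openMaximal (c + 1) (E.indicator fun _ => 1) x} := by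
  intro x hx
  obtain ⟨ε, hε, hball⟩ := Metric.isOpen_iff.1 hE x hx
  set r : (Fin d → ℝ) × (Fin d → ℝ) := (fun i => x i - ε / 2, fun i => x i + ε / 2) with hr
  have hcomp : HasComplexity (c + 1) r := by
    refine ⟨fun i => by simp only [hr]; linarith, ?_⟩
    have : Finset.image (fun i => r.2 i - r.1 i) Finset.univ ⊆ {ε} := fun s hs => by
      obtain ⟨i, -, rfl⟩ := Finset.mem_image.1 hs
      simp only [hr, Finset.mem_singleton]; ring
    exact (Finset.card_le_card this).trans (by simp)
  have hsub : openBox r ⊆ E := fun y hy => hball <| by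
    rw [Metric.mem_ball, dist_pi_lt_iff hε]
    intro i
    have := mem_openBox.1 hy i
    simp only [hr] at this
    rw [Real.dist_eq, abs_lt]
    constructor <;> linarith
  have hxr : x ∈ openBox r := mem_openBox.2 fun i => by
    constructor <;> simp only [hr] <;> linarith
  refine lt_of_lt_of_le ?_ (hcomp.average_le_openMaximal hxr)
  rw [setLIntegral_congr_fun measurableSet_openBox
    (g := fun _ => (1 : ℝ≥0∞)) fun y hy => Set.indicator_of_mem (hsub hy) _,
    setLIntegral_one, ENNReal.div_self hcomp.volume_ne_zero volume_openBox_ne_top]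
  simp

theorem exists_lintegral_halo_le (hd : 1 ≤ d) (c : ℕ) :
    ∃ H : ℝ≥0∞, H ≠ ⊤ ∧ ∀ w : (Fin d → ℝ) → ℝ≥0∞, Measurable w →
      ∀ E : Set (Fin d → ℝ), IsOpen E →
      ∫⁻ x in halo c E, w x ≤ H * ∫⁻ x in E, iterOpenMaximal c w x := by
  induction c with
  | zero =>
    refine ⟨1, ENNReal.one_ne_top, fun w _ E _ => ?_⟩
    have : halo 0 E = E := by
      simp [halo, openMaximal_zero hd]
    rw [this, one_mul]
    rfl
  | succ c ih =>
    obtain ⟨H, hHtop, hH⟩ := ih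
    obtain ⟨K, hKtop, hK⟩ := exists_lintegral_openMaximal_rpow_le d one_lt_two
    refine ⟨2 ^ 2 * (2 ^ d * (H * (3 ^ d * 2 * K))), by finiteness, fun w hw E hE => ?_⟩
    have h := openMaximal_weak_type_of_halo hd two_pos hH (hK (c + 1)) hw
      (measurable_const.indicator hE.measurableSet : Measurable (E.indicator fun _ => (1 : ℝ≥0∞)))
      (t := 1 / 2) (by simp) (by simp)
    have h2 : ∫⁻ x, (E.indicator (fun _ => (1 : ℝ≥0∞)) x) ^ (2 : ℝ) *
        iterOpenMaximal (c + 1) w x = ∫⁻ x in E, iterOpenMaximal (c + 1) w x := by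
      rw [← lintegral_indicator hE.measurableSet]
      refine lintegral_congr fun x => ?_
      by_cases hx : x ∈ E <;> simp [hx]
    have h3 : (2 : ℝ≥0∞) ^ 2 * (1 / 2) ^ (2 : ℝ) = 1 := by
      rw [ENNReal.rpow_ofNat, ← mul_pow, ENNReal.mul_div_cancel (by simp) (by simp), one_pow]
    have h4 : halo (c + 1) E = {x | 1 / 2 < openMaximal (c + 1) (E.indicator fun _ => 1) x} :=
      Set.union_eq_right.2 (subset_setOf_lt_openMaximal_indicator hE)
    rw [h2] at h
    rw [h4]
    calc _ = 2 ^ 2 * ((1 / 2) ^ (2 : ℝ) * ∫⁻ x in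
          {x | 1 / 2 < openMaximal (c + 1) (E.indicator fun _ => 1) x}, w x) := by
          rw [← mul_assoc, h3, one_mul]
      _ ≤ _ := by
          rw [mul_assoc]
          gcongr 1

theorem exists_lintegral_openMaximal_rpow_mul_le (hd : 1 ≤ d) (c : ℕ) {p : ℝ} (hp : 1 < p) :
    ∃ K : ℝ≥0∞, K ≠ ⊤ ∧ ∀ w f : (Fin d → ℝ) → ℝ≥0∞, Measurable w → Measurable f →
      ∫⁻ x, openMaximal (c + 1) f x ^ p * w x ≤
        K * ∫⁻ x, f x ^ p * iterOpenMaximal (c + 1) w x := by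
  obtain ⟨q, hq1, hqp⟩ := exists_between hp
  have hq : 0 < q := zero_lt_one.trans hq1
  obtain ⟨H, hHtop, hH⟩ := exists_lintegral_halo_le hd c
  obtain ⟨A, hAtop, hA⟩ := exists_lintegral_openMaximal_rpow_le d hq1
  obtain ⟨K, hKtop, hK⟩ := exists_lintegral_rpow_le_of_weak_type hq hqp
    (A := 2 ^ q * (2 ^ d * (H * (3 ^ d * 2 * A)))) (by finiteness)
  refine ⟨K, hKtop, fun w f hw hf => ?_⟩
  have hW : Measurable (iterOpenMaximal (c + 1) w) := measurable_openMaximal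
  have h := hK (volume.withDensity w) (volume.withDensity (iterOpenMaximal (c + 1) w)) f
    (openMaximal (c + 1) f) hf measurable_openMaximal fun t ht => ?_
  · rw [lintegral_withDensity_eq_lintegral_mul _ hw (measurable_openMaximal.pow_const p),
      lintegral_withDensity_eq_lintegral_mul _ hW (hf.pow_const p)] at h
    simpa only [Pi.mul_apply, mul_comm] using h
  set T := ENNReal.ofReal t with hT
  have hT0 : T ≠ 0 := by simpa [hT] using ht
  have hTtop : T ≠ ⊤ := ENNReal.ofReal_ne_top
  have hS : MeasurableSet {x | T < 2 * f x} := measurableSet_lt measurable_const (by fun_prop)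
  set f₁ := {x | T < 2 * f x}.indicator f with hf₁
  have hsub : {x | T < openMaximal (c + 1) f x} ⊆ {x | T / 2 < openMaximal (c + 1) f₁ x} := by
    intro x hx
    by_contra hle
    have h2 : openMaximal (c + 1) f₁ x ≤ T / 2 := not_lt.1 hle
    have : openMaximal (c + 1) f x ≤ T := (openMaximal_le_truncation T x).trans
      ((add_le_add_left h2 _).trans (ENNReal.add_halves T).le)
    exact absurd hx (not_lt.2 this)
  have hweak := openMaximal_weak_type_of_halo hd hq hH (hA (c + 1)) hw (hf.indicator hS)
    (t := T / 2) (by simpa using hT0) (ENNReal.div_ne_top hTtop (by simp))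
  have hint : ∫⁻ x, f₁ x ^ q * iterOpenMaximal (c + 1) w x =
      ∫⁻ x in {x | T < 2 * f x}, f x ^ q ∂volume.withDensity (iterOpenMaximal (c + 1) w) := by
    rw [restrict_withDensity hS, lintegral_withDensity_eq_lintegral_mul _ hW (hf.pow_const q),
      ← lintegral_indicator hS]
    refine lintegral_congr fun x => ?_
    by_cases hx : x ∈ {x | T < 2 * f x}
    · rw [hf₁, Set.indicator_of_mem hx, Set.indicator_of_mem hx, Pi.mul_apply, mul_comm]
    · simp [hf₁, Set.indicator_of_notMem hx, ENNReal.zero_rpow_of_pos hq]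
  rw [withDensity_apply _ (isOpen_setOf_lt_openMaximal T).measurableSet, ← hint]
  calc T ^ q * ∫⁻ x in {x | T < openMaximal (c + 1) f x}, w x
      ≤ T ^ q * ∫⁻ x in {x | T / 2 < openMaximal (c + 1) f₁ x}, w x := by
        gcongr 1
        exact lintegral_mono_set hsub
    _ = 2 ^ q * ((T / 2) ^ q * ∫⁻ x in {x | T / 2 < openMaximal (c + 1) f₁ x}, w x) := by
        rw [← mul_assoc, ← ENNReal.mul_rpow_of_nonneg _ _ hq.le,
          ENNReal.mul_div_cancel (by simp) (by simp)]
    _ ≤ _ := by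
        rw [mul_assoc]
        exact mul_le_mul_right hweak _

end WeakType

/-- The Fefferman–Stein type strong `L^p` inequality for the strong maximal operator of
complexity `c` with the composed weight `W = 𝔐_c 𝔐_{c-1} ⋯ 𝔐_1 w`. -/
theorem fefferman_stein_strong_type_composition
    (d c : ℕ) (hd : 1 ≤ d) (hc : 1 ≤ c) (hcd : c ≤ d) (p : ℝ) (hp : 1 < p) :
    ∃ C : ℝ, 0 < C ∧
      ∀ w : (Fin d → ℝ) → ℝ, (∀ x, 0 ≤ w x) → LocallyIntegrable w →
      ∀ f : (Fin d → ℝ) → ℝ, LocallyIntegrable f →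
        (∫⁻ x, strongMaximal d c (fun y => ENNReal.ofReal |f y|) x ^ p *
            ENNReal.ofReal (w x)) ^ (1 / p)
          ≤ ENNReal.ofReal C *
            (∫⁻ x, ENNReal.ofReal |f x| ^ p *
              iterMaximal d c (fun y => ENNReal.ofReal (w y)) x) ^ (1 / p) := by
  obtain ⟨c, rfl⟩ : ∃ n, c = n + 1 := ⟨c - 1, by omega⟩
  have hp0 : 0 < p := zero_lt_one.trans hp
  obtain ⟨K, hK, h⟩ := exists_lintegral_openMaximal_rpow_mul_le hd c hp
  set A : ℝ≥0∞ := (((3 : ℝ≥0∞) ^ d) ^ p * K) ^ (1 / p) with hA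
  have h3 : ((3 : ℝ≥0∞) ^ d) ^ p ≠ ⊤ := ENNReal.rpow_ne_top_of_nonneg hp0.le (by simp)
  have hAtop : A ≠ ⊤ :=
    ENNReal.rpow_ne_top_of_nonneg (by positivity) (ENNReal.mul_ne_top h3 hK)
  refine ⟨A.toReal + 1, by positivity, fun w _ hw f hf => ?_⟩
  have hwm : AEMeasurable (fun y => ENNReal.ofReal (w y)) :=
    hw.aestronglyMeasurable.aemeasurable.ennreal_ofReal
  have hfm : AEMeasurable (fun y => ENNReal.ofReal |f y|) :=
    hf.aestronglyMeasurable.aemeasurable.abs.ennreal_ofReal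
  set w' := hwm.mk
  set f' := hfm.mk
  have hAC : A ≤ ENNReal.ofReal (A.toReal + 1) := by
    calc A = ENNReal.ofReal A.toReal := (ENNReal.ofReal_toReal hAtop).symm
      _ ≤ _ := ENNReal.ofReal_le_ofReal (by linarith)
  refine le_trans ?_ (mul_le_mul_left hAC _)
  rw [hA, ← ENNReal.mul_rpow_of_nonneg _ _ (by positivity)]
  refine ENNReal.rpow_le_rpow ?_ (by positivity)
  calc ∫⁻ x, strongMaximal d (c + 1) (fun y => ENNReal.ofReal |f y|) x ^ p * ENNReal.ofReal (w x)
      ≤ ∫⁻ x, (3 ^ d) ^ p * (openMaximal (c + 1) f' x ^ p * w' x) := by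
        refine lintegral_mono_ae ?_
        filter_upwards [hwm.ae_eq_mk] with x hx
        rw [hx, ← mul_assoc, ← ENNReal.mul_rpow_of_nonneg _ _ hp0.le,
          ← openMaximal_congr_ae hfm.ae_eq_mk]
        gcongr
        exact strongMaximal_le_openMaximal x
    _ = (3 ^ d) ^ p * ∫⁻ x, openMaximal (c + 1) f' x ^ p * w' x := lintegral_const_mul' _ _ h3
    _ ≤ (3 ^ d) ^ p * (K * ∫⁻ x, f' x ^ p * iterOpenMaximal (c + 1) w' x) := by
        gcongr 1
        exact h w' f' hwm.measurable_mk hfm.measurable_mk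
    _ ≤ (3 ^ d) ^ p * (K * ∫⁻ x, ENNReal.ofReal |f x| ^ p *
          iterMaximal d (c + 1) (fun y => ENNReal.ofReal (w y)) x) := by
        gcongr 2
        refine lintegral_mono_ae ?_
        filter_upwards [hfm.ae_eq_mk] with x hx
        rw [hx, ← iterOpenMaximal_congr_ae hwm.ae_eq_mk]
        gcongr
        exact iterOpenMaximal_le_iterMaximal x
    _ = _ := (mul_assoc _ _ _).symm
end

section
/- Let d ≥ 1 and let c be an integer with 1 ≤ c ≤ d. There is a constant C > 0, depending only on d and c, such that for every locally integrable f on ℝ^d and every t > 0, the Lebesgue measure of {x ∈ ℝ^d : 𝔐_c f(x) > t} is at most C ∫_{ℝ^d} (|f|/t) (1 + log⁺(|f|/t))^{c−1} dx, where log⁺ s = max(0, log s). -/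
open MeasureTheory ENNReal

open Metric in
/-- Covering estimate behind the weak `(1,1)` bound for maximal functions over cubes. -/
theorem mul_volume_iUnion_closedBall_le {κ A : Type*} [Fintype κ] (x : A → κ → ℝ) (r : A → ℝ)
    (hr : ∀ a, 0 < r a) (f : (κ → ℝ) → ℝ≥0∞) (t : ℝ≥0∞)
    (h : ∀ a, t * volume (closedBall (x a) (r a)) ≤ ∫⁻ y in closedBall (x a) (r a), f y) :
    t * volume (⋃ a, closedBall (x a) (r a)) ≤ 5 ^ Fintype.card κ * ∫⁻ y, f y := by
  have key : ∀ K : ℕ, t * volume (⋃ a ∈ {a | r a ≤ K}, closedBall (x a) (r a))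
      ≤ 5 ^ Fintype.card κ * ∫⁻ y, f y := by
    intro K
    obtain ⟨u, -, hdisj, hcov⟩ := Vitali.exists_disjoint_subfamily_covering_enlargement_closedBall
      {a | r a ≤ K} x r K (fun a ha => ha) 5 (by norm_num)
    have hcount : u.Countable := hdisj.countable_of_nonempty_interior fun a _ =>
      (nonempty_ball.2 (hr a)).mono ball_subset_interior_closedBall
    have hvol : ∀ a, volume (closedBall (x a) (5 * r a))
        = 5 ^ Fintype.card κ * volume (closedBall (x a) (r a)) := by
      intro a
      rw [Real.volume_pi_closedBall _ (by have := hr a; positivity),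
        Real.volume_pi_closedBall _ (hr a).le, mul_left_comm, mul_pow,
        ofReal_mul (by positivity), ofReal_pow (by norm_num)]
      norm_num
    calc t * volume (⋃ a ∈ {a | r a ≤ K}, closedBall (x a) (r a))
        ≤ t * volume (⋃ b ∈ u, closedBall (x b) (5 * r b)) := by
          gcongr t * volume ?_
          refine Set.iUnion₂_subset fun a ha => ?_
          obtain ⟨b, hb, hab⟩ := hcov a ha
          exact hab.trans
            (Set.subset_biUnion_of_mem (s := u) (u := fun b => closedBall (x b) (5 * r b)) hb)
      _ ≤ t * ∑' b : u, volume (closedBall (x b) (5 * r b)) := by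
          gcongr
          exact measure_biUnion_le _ hcount _
      _ = 5 ^ Fintype.card κ * ∑' b : u, t * volume (closedBall (x b) (r b)) := by
          simp_rw [hvol, ENNReal.tsum_mul_left]
          ring
      _ ≤ 5 ^ Fintype.card κ * ∑' b : u, ∫⁻ y in closedBall (x b) (r b), f y := by
          gcongr
          exact h _
      _ = 5 ^ Fintype.card κ * ∫⁻ y in ⋃ b ∈ u, closedBall (x b) (r b), f y := by
          rw [lintegral_biUnion hcount (fun _ _ => measurableSet_closedBall) hdisj]
      _ ≤ _ := by
          gcongr
          exact Measure.restrict_le_self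
  have hU : (⋃ a, closedBall (x a) (r a))
      = ⋃ K : ℕ, ⋃ a ∈ {a | r a ≤ K}, closedBall (x a) (r a) := by
    ext y
    simp only [Set.mem_iUnion, Set.mem_ofPred_eq, exists_prop]
    constructor
    · rintro ⟨a, ha⟩
      obtain ⟨K, hK⟩ := exists_nat_ge (r a)
      exact ⟨K, a, hK, ha⟩
    · rintro ⟨-, a, -, ha⟩
      exact ⟨a, ha⟩
  rw [hU, Monotone.measure_iUnion, ENNReal.mul_iSup]
  · exact iSup_le key
  · intro K L hKL
    exact Set.biUnion_subset_biUnion_left fun a (ha : r a ≤ K) =>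
      ha.trans (by exact_mod_cast hKL)

/-- The number of `k : ℕ` with `2 ^ k < s`. -/
noncomputable def dyadicCount (s : ℝ≥0∞) : ℝ≥0∞ :=
  ∑' k : ℕ, if 2 ^ k < s then 1 else 0

theorem dyadicCount_mono : Monotone dyadicCount := by
  intro a b hab
  refine ENNReal.tsum_le_tsum fun k => ?_
  split_ifs with h1 h2
  · rfl
  · exact absurd (h1.trans_le hab) h2
  · simp
  · rfl

theorem dyadicCount_two_mul_le (s : ℝ≥0∞) : dyadicCount (2 * s) ≤ 1 + dyadicCount s := by
  rw [dyadicCount, tsum_eq_zero_add' ENNReal.summable]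
  gcongr
  · split_ifs <;> simp
  · refine ENNReal.tsum_le_tsum fun k => ?_
    simp only [pow_succ', ENNReal.mul_lt_mul_iff_right two_ne_zero ofNat_ne_top, le_refl]

theorem dyadicCount_two_pow_mul_le (j : ℕ) (s : ℝ≥0∞) :
    dyadicCount (2 ^ j * s) ≤ j + dyadicCount s := by
  induction j with
  | zero => simp
  | succ j ih =>
    rw [pow_succ', mul_assoc]
    refine (dyadicCount_two_mul_le _).trans ?_
    push_cast
    rw [add_comm (j : ℝ≥0∞) 1, add_assoc]
    gcongr

theorem dyadicCount_le_of_le_two_pow {n : ℕ} {s : ℝ≥0∞} (h : s ≤ 2 ^ n) : dyadicCount s ≤ n := by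
  rw [dyadicCount, tsum_eq_sum (s := Finset.range n)]
  · refine (Finset.sum_le_card_nsmul _ _ 1 fun k _ => ?_).trans (by simp)
    split_ifs <;> simp
  · intro k hk
    rw [if_neg]
    rw [Finset.mem_range, not_lt] at hk
    exact not_lt.2 (h.trans (pow_le_pow_right₀ one_le_two hk))

theorem one_add_dyadicCount_ofReal_le (r : ℝ) :
    1 + dyadicCount (ENNReal.ofReal r) ≤ ENNReal.ofReal (2 * (1 + max 0 (Real.log r))) := by
  have hlog2 : 1 / 2 < Real.log 2 := by have := Real.log_two_gt_d9; linarith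
  set n := ⌈2 * max 0 (Real.log r)⌉₊ with hn
  have hceil : 2 * max 0 (Real.log r) ≤ n := Nat.le_ceil _
  have hle : r ≤ 2 ^ n := by
    rcases le_or_gt r 0 with h | h
    · exact h.trans (by positivity)
    · rw [← Real.log_le_log_iff h (by positivity), Real.log_pow]
      have : Real.log r ≤ max 0 (Real.log r) := le_max_right _ _
      nlinarith [(Nat.cast_nonneg n : (0 : ℝ) ≤ n)]
  have h1 : dyadicCount (ENNReal.ofReal r) ≤ n := by
    apply dyadicCount_le_of_le_two_pow
    refine (ENNReal.ofReal_le_ofReal hle).trans ?_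
    rw [ofReal_pow (by norm_num)]
    norm_num
  have h2 : (n : ℝ) ≤ 2 * max 0 (Real.log r) + 1 :=
    (Nat.ceil_lt_add_one (by positivity)).le
  calc 1 + dyadicCount (ENNReal.ofReal r) ≤ 1 + n := by gcongr
    _ = ENNReal.ofReal (1 + n) := by
      rw [ofReal_add (by norm_num) (by positivity)]; simp
    _ ≤ _ := ENNReal.ofReal_le_ofReal (by linarith)

theorem le_tsum_dyadic (s : ℝ≥0∞) (hs : 1 < s) :
    s ≤ ∑' k : ℕ, if 2 ^ k < s then 2 ^ (k + 1) else 0 := by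
  rcases eq_or_ne s ∞ with rfl | hfin
  · refine top_le_iff.2 ?_
    have : ∀ k : ℕ, (2 : ℝ≥0∞) ^ k < ∞ := fun k => ENNReal.pow_lt_top (by norm_num)
    simp only [this, if_true]
    refine top_le_iff.1 ((ENNReal.tsum_const_eq_top_of_ne_zero (α := ℕ) one_ne_zero).symm.le.trans
      (ENNReal.tsum_le_tsum fun k => one_le_pow₀ one_le_two))
  · obtain ⟨m, hm⟩ : ∃ m : ℕ, s ≤ 2 ^ m := by
      obtain ⟨m, hm⟩ := ENNReal.exists_nat_gt hfin
      refine ⟨m, hm.le.trans ?_⟩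
      exact_mod_cast Nat.lt_two_pow_self.le
    have hex : ∃ m : ℕ, s ≤ 2 ^ m := ⟨m, hm⟩
    classical
    have hpos : Nat.find hex ≠ 0 := by
      intro h0
      have := Nat.find_spec hex
      rw [h0, pow_zero] at this
      exact absurd hs this.not_gt
    obtain ⟨k, hk⟩ := Nat.exists_eq_succ_of_ne_zero hpos
    have h1 : s ≤ 2 ^ (k + 1) := by
      have := Nat.find_spec hex
      rwa [hk] at this
    have h2 : 2 ^ k < s := not_le.1 (Nat.find_min hex (by omega))
    refine h1.trans (le_trans ?_ (ENNReal.le_tsum k))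
    rw [if_pos h2]

theorem le_indicator_add {X : Type*} (f : X → ℝ≥0∞) (t : ℝ≥0∞) (x : X) :
    f x ≤ {x | t < f x}.indicator f x + t := by
  by_cases hx : t < f x
  · rw [Set.indicator_of_mem (by exact hx)]; exact le_self_add
  · exact (not_lt.1 hx).trans le_add_self

theorem lintegral_indicator_le_tsum {X : Type*} [MeasureSpace X] {g : X → ℝ≥0∞}
    (hg : Measurable g) {t : ℝ≥0∞} (ht : t ≠ 0) (ht' : t ≠ ∞) :
    ∫⁻ x, {x | t < g x}.indicator g x
      ≤ ∑' k : ℕ, 2 ^ (k + 1) * t * volume {x | 2 ^ k * t < g x} := by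
  have hm : ∀ k : ℕ, MeasurableSet {x | 2 ^ k * t < g x} :=
    fun k => measurableSet_lt measurable_const hg
  calc ∫⁻ x, {x | t < g x}.indicator g x
      ≤ ∫⁻ x, ∑' k : ℕ, {x | 2 ^ k * t < g x}.indicator (fun _ => 2 ^ (k + 1) * t) x := by
        refine lintegral_mono fun x => ?_
        by_cases hx : t < g x
        · rw [Set.indicator_of_mem (by exact hx)]
          have h1 : 1 < g x / t := by
            rwa [ENNReal.lt_div_iff_mul_lt (Or.inl ht) (Or.inl ht'), one_mul]
          calc g x = g x / t * t := (ENNReal.div_mul_cancel ht ht').symm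
            _ ≤ (∑' k : ℕ, if 2 ^ k < g x / t then 2 ^ (k + 1) else 0) * t := by
                gcongr
                exact le_tsum_dyadic _ h1
            _ = _ := by
                rw [← ENNReal.tsum_mul_right]
                refine tsum_congr fun k => ?_
                simp only [ENNReal.lt_div_iff_mul_lt (Or.inl ht) (Or.inl ht'), Set.indicator_apply,
                  Set.mem_ofPred_eq, ite_mul, zero_mul]
        · rw [Set.indicator_of_notMem (by exact hx)]
          exact zero_le
    _ = _ := by
        rw [lintegral_tsum fun k => (measurable_const.indicator (hm k)).aemeasurable]
        refine tsum_congr fun k => ?_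
        rw [lintegral_indicator_const (hm k)]

theorem exists_block_sides {ι : Type*} [Fintype ι] {c : ℕ} (l : ι → ℝ)
    (hl : (Finset.image l Finset.univ).card ≤ c) :
    ∃ φ : ι → Fin c, ∀ i j, φ i = φ j → l i = l j := by
  obtain ⟨e⟩ : Nonempty (Finset.image l Finset.univ ↪ Fin c) :=
    Function.Embedding.nonempty_of_card_le (by simpa using hl)
  refine ⟨fun i => e ⟨l i, Finset.mem_image_of_mem l (Finset.mem_univ i)⟩, fun i j hij => ?_⟩
  simpa using e.injective hij

/-- The interval `[2 ^ k * m, 2 ^ k * (m + 2)]`. -/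
def gridInterval (k m : ℤ) : Set ℝ := Metric.closedBall (2 ^ k * (m + 1)) (2 ^ k)

theorem volume_gridInterval (k m : ℤ) : volume (gridInterval k m) = ENNReal.ofReal (2 * 2 ^ k) := by
  rw [gridInterval, Real.volume_closedBall]

section Operators

variable {ι : Type*} [Fintype ι] [DecidableEq ι]

/-- The maximal operator over grid cubes in the block of coordinates `s`. -/
noncomputable def blockMaximal (s : Finset ι) (f : (ι → ℝ) → ℝ≥0∞) (x : ι → ℝ) : ℝ≥0∞ :=
  ⨆ (k : ℤ) (m : ι → ℤ), {x : ι → ℝ | ∀ i ∈ s, x i ∈ gridInterval k (m i)}.indicator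
    (fun x => (ENNReal.ofReal (2 * 2 ^ k) ^ s.card)⁻¹ *
      lmarginal (fun i => volume.restrict (gridInterval k (m i))) s f x) x

theorem Measurable.blockMaximal {s : Finset ι} {f : (ι → ℝ) → ℝ≥0∞} (hf : Measurable f) :
    Measurable (blockMaximal s f) := by
  refine Measurable.iSup fun k => Measurable.iSup fun m => ?_
  refine ((hf.lmarginal _).const_mul _).indicator ?_
  have : {x : ι → ℝ | ∀ i ∈ s, x i ∈ gridInterval k (m i)}
      = ⋂ i ∈ s, (fun x : ι → ℝ => x i) ⁻¹' gridInterval k (m i) := by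
    ext; simp
  rw [this]
  exact Finset.measurableSet_biInter _ fun i _ =>
    Metric.isClosed_closedBall.measurableSet.preimage (measurable_pi_apply i)

theorem gridWeight_ne_zero (k : ℤ) (n : ℕ) : ENNReal.ofReal (2 * 2 ^ k) ^ n ≠ 0 :=
  pow_ne_zero _ (by rw [Ne, ENNReal.ofReal_eq_zero, not_le]; positivity)

theorem gridWeight_ne_top (k : ℤ) (n : ℕ) : ENNReal.ofReal (2 * 2 ^ k) ^ n ≠ ∞ :=
  ENNReal.pow_ne_top ofReal_ne_top

theorem blockMaximal_le_add {s : Finset ι} {f g : (ι → ℝ) → ℝ≥0∞} (hg : Measurable g)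
    (t : ℝ≥0∞) (h : ∀ x, f x ≤ g x + t) (x : ι → ℝ) :
    blockMaximal s f x ≤ blockMaximal s g x + t := by
  refine iSup₂_le fun k m => ?_
  by_cases hx : ∀ i ∈ s, x i ∈ gridInterval k (m i)
  swap
  · rw [Set.indicator_of_notMem (by exact hx)]; exact zero_le
  refine le_trans ?_ (add_le_add_left (le_iSup₂ k m) t)
  rw [Set.indicator_of_mem (by exact hx), Set.indicator_of_mem (by exact hx)]
  have h1 : lmarginal (fun i => volume.restrict (gridInterval k (m i))) s f x
      ≤ lmarginal (fun i => volume.restrict (gridInterval k (m i))) s g x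
        + t * ENNReal.ofReal (2 * 2 ^ k) ^ s.card := by
    refine (lintegral_mono fun y => h _).trans ?_
    have hgu : Measurable fun y : s → ℝ => g (Function.updateFinset x s y) :=
      hg.comp measurable_updateFinset
    rw [lintegral_add_left hgu, lintegral_const, Measure.pi_univ]
    simp [lmarginal, volume_gridInterval]
  refine (mul_le_mul_right h1 _).trans ?_
  rw [mul_add]
  gcongr
  rw [mul_left_comm, ENNReal.inv_mul_cancel (gridWeight_ne_zero _ _) (gridWeight_ne_top _ _),
    mul_one]

theorem mul_volume_lt_blockMaximal_le {s : Finset ι} {f : (ι → ℝ) → ℝ≥0∞} (hf : Measurable f)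
    (t : ℝ≥0∞) :
    t * volume {x | t < blockMaximal s f x} ≤ 5 ^ Fintype.card ι * ∫⁻ x, f x := by
  have hE : MeasurableSet {x | t < blockMaximal s f x} :=
    measurableSet_lt measurable_const hf.blockMaximal
  have hind : Measurable fun x => t * {x | t < blockMaximal s f x}.indicator 1 x :=
    ((measurable_one (α := ℝ≥0∞)).indicator hE).const_mul t
  rw [← lintegral_indicator_one hE, ← lintegral_const_mul _ (measurable_one.indicator hE),
    ← lintegral_const_mul _ hf]
  refine lintegral_le_of_lmarginal_le s hind (hf.const_mul _) fun x => ?_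
  have hup : Measurable fun y : s → ℝ => Function.updateFinset x s y := measurable_updateFinset
  simp only [lmarginal]
  have hfu : Measurable fun y : s → ℝ => f (Function.updateFinset x s y) := hf.comp hup
  have hEu : Measurable fun y : s → ℝ =>
      {x | t < blockMaximal s f x}.indicator (1 : (ι → ℝ) → ℝ≥0∞) (Function.updateFinset x s y) :=
    (measurable_one.indicator hE).comp hup
  rw [lintegral_const_mul _ hEu, lintegral_const_mul _ hfu]
  have hrw : ∀ y : s → ℝ, {x | t < blockMaximal s f x}.indicator (1 : (ι → ℝ) → ℝ≥0∞)
      (Function.updateFinset x s y)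
      = ((Function.updateFinset x s) ⁻¹' {x | t < blockMaximal s f x}).indicator 1 y :=
    fun y => rfl
  simp_rw [hrw]
  rw [lintegral_indicator_one (hup hE)]
  have hball : ∀ (k : ℤ) (m : s → ℤ),
      Metric.closedBall (fun i => (2 : ℝ) ^ k * (m i + 1)) ((2 : ℝ) ^ k)
        = Set.univ.pi fun i => gridInterval k (m i) :=
    fun k m => closedBall_pi _ (by positivity)
  let A := {a : ℤ × (s → ℤ) // t * ENNReal.ofReal (2 * 2 ^ a.1) ^ s.card ≤
    ∫⁻ y in Set.univ.pi fun i => gridInterval a.1 (a.2 i), f (Function.updateFinset x s y)}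
  have key := mul_volume_iUnion_closedBall_le (A := A) (fun a i => (2 : ℝ) ^ a.1.1 * (a.1.2 i + 1))
    (fun a => (2 : ℝ) ^ a.1.1) (fun a => by positivity)
    (fun y => f (Function.updateFinset x s y)) t (by
      rintro ⟨⟨k, m⟩, ha⟩
      rw [Real.volume_pi_closedBall _ (by positivity), hball, ofReal_pow (by positivity),
        Fintype.card_coe]
      exact ha)
  refine (mul_le_mul_right (measure_mono fun y hy => ?_) t).trans (key.trans ?_)
  · simp only [Set.mem_preimage, Set.mem_ofPred_eq, blockMaximal, lt_iSup_iff] at hy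
    obtain ⟨k, m, hkm⟩ := hy
    by_cases hx : ∀ i ∈ s, Function.updateFinset x s y i ∈ gridInterval k (m i)
    swap
    · rw [Set.indicator_of_notMem (by exact hx)] at hkm; simp at hkm
    rw [Set.indicator_of_mem (by exact hx)] at hkm
    refine Set.mem_iUnion.2 ⟨⟨(k, fun i => m i), ?_⟩, ?_⟩
    · rw [mul_comm, ← div_eq_mul_inv] at hkm
      have := (ENNReal.lt_div_iff_mul_lt (Or.inl (gridWeight_ne_zero _ _))
        (Or.inl (gridWeight_ne_top _ _))).1 hkm
      refine this.le.trans (le_of_eq ?_)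
      rw [volume_pi, Measure.restrict_pi_pi]
      refine lintegral_congr fun z => congrArg f ?_
      ext i
      by_cases hi : i ∈ s <;> simp [Function.updateFinset, hi]
    · show y ∈ Metric.closedBall (fun i : s => (2 : ℝ) ^ k * (m i + 1)) ((2 : ℝ) ^ k)
      rw [hball k (fun i => m i)]
      intro i _
      have := hx i i.2
      simpa [Function.updateFinset] using this
  · rw [volume_pi]
    gcongr
    · norm_num
    · simpa using Finset.card_le_univ s

/-- The composition of the block maximal operators over `s 0, …, s (n - 1)`. -/
noncomputable def iterBlockMaximal (s : ℕ → Finset ι) (f : (ι → ℝ) → ℝ≥0∞) :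
    ℕ → (ι → ℝ) → ℝ≥0∞
  | 0 => f
  | n + 1 => blockMaximal (s n) (iterBlockMaximal s f n)

theorem Measurable.iterBlockMaximal (s : ℕ → Finset ι) {f : (ι → ℝ) → ℝ≥0∞} (hf : Measurable f) :
    ∀ n, Measurable (iterBlockMaximal s f n)
  | 0 => hf
  | n + 1 => (hf.iterBlockMaximal s n).blockMaximal

theorem iterBlockMaximal_le_add (s : ℕ → Finset ι) {f g : (ι → ℝ) → ℝ≥0∞} (hg : Measurable g)
    (t : ℝ≥0∞) (h : ∀ x, f x ≤ g x + t) :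
    ∀ n x, iterBlockMaximal s f n x ≤ iterBlockMaximal s g n x + t
  | 0 => h
  | n + 1 => blockMaximal_le_add (hg.iterBlockMaximal s n) t (iterBlockMaximal_le_add s hg t h n)

/-- The Orlicz integrand `s (1 + N(s)) ^ n`, where `N` counts dyadic levels below `s`. -/
noncomputable def dyadicLLog (n : ℕ) (s : ℝ≥0∞) : ℝ≥0∞ := s * (1 + dyadicCount s) ^ n

theorem measurable_dyadicLLog (n : ℕ) : Measurable (dyadicLLog n) :=
  measurable_id.mul ((dyadicCount_mono.measurable.const_add 1).pow_const n)

theorem volume_two_mul_lt_iterBlockMaximal_le (s : ℕ → Finset ι) {n m : ℕ} {C : ℝ≥0∞}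
    (hC : ∀ f : (ι → ℝ) → ℝ≥0∞, Measurable f → ∀ t, t ≠ 0 → t ≠ ∞ →
      volume {x | t < iterBlockMaximal s f m x} ≤ C * ∫⁻ x, dyadicLLog n (f x / t))
    {f : (ι → ℝ) → ℝ≥0∞} (hf : Measurable f) {t : ℝ≥0∞} (ht : t ≠ 0) (ht' : t ≠ ∞) :
    volume {x | 2 * t < iterBlockMaximal s f m x}
      ≤ C * ∫⁻ x, if t < f x then dyadicLLog n (f x / t) else 0 := by
  have hg : Measurable ({x | t < f x}.indicator f) :=
    hf.indicator (measurableSet_lt measurable_const hf)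
  refine (measure_mono fun x hx => ?_).trans ((hC _ hg t ht ht').trans_eq ?_)
  · rw [Set.mem_ofPred_eq] at hx
    have := hx.trans_le (iterBlockMaximal_le_add s hg t (le_indicator_add f t) m x)
    rw [two_mul] at this
    exact (ENNReal.add_lt_add_iff_right ht').1 this
  · congr 1
    refine lintegral_congr fun x => ?_
    by_cases hx : t < f x
    · rw [Set.indicator_of_mem (by exact hx), if_pos hx]
    · rw [Set.indicator_of_notMem (by exact hx), if_neg hx]
      simp [dyadicLLog]

theorem dyadicLLog_four_mul_le (n : ℕ) (u : ℝ≥0∞) :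
    dyadicLLog n (4 * u) ≤ 4 * 3 ^ n * dyadicLLog n u := by
  have h : 1 + dyadicCount (4 * u) ≤ 3 * (1 + dyadicCount u) := by
    have h4 : (4 : ℝ≥0∞) = 2 ^ 2 := by norm_num
    rw [h4]
    calc 1 + dyadicCount (2 ^ 2 * u) ≤ 1 + ((2 : ℕ) + dyadicCount u) := by
          gcongr
          exact dyadicCount_two_pow_mul_le 2 u
      _ = 3 + 1 * dyadicCount u := by push_cast; ring
      _ ≤ 3 + 3 * dyadicCount u := by gcongr; norm_num
      _ = _ := by ring
  calc dyadicLLog n (4 * u) ≤ 4 * u * (3 * (1 + dyadicCount u)) ^ n := by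
        unfold dyadicLLog; gcongr
    _ = _ := by rw [dyadicLLog, mul_pow]; ring

theorem tsum_dyadicLLog_le (n : ℕ) {t : ℝ≥0∞} (ht : t ≠ 0) (ht' : t ≠ ∞) (v : ℝ≥0∞) :
    (∑' k : ℕ, 2 ^ (k + 1) * (2 * t) *
        if 2 ^ k * t < v then dyadicLLog n (v / (2 ^ k * t)) else 0)
      ≤ 2 * t * (2 * dyadicLLog (n + 1) (v / t)) := by
  have h2 : ∀ k : ℕ, (2 : ℝ≥0∞) ^ k ≠ 0 := fun k => pow_ne_zero _ two_ne_zero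
  have h2' : ∀ k : ℕ, (2 : ℝ≥0∞) ^ k ≠ ∞ := fun k => ENNReal.pow_ne_top ofNat_ne_top
  calc _ ≤ ∑' k : ℕ, 2 * t * (2 * dyadicLLog n (v / t)) * if 2 ^ k < v / t then 1 else 0 := by
        refine ENNReal.tsum_le_tsum fun k => ?_
        simp only [ENNReal.lt_div_iff_mul_lt (Or.inl ht) (Or.inl ht')]
        split_ifs with hk
        swap
        · simp
        have hdiv : v / (2 ^ k * t) = (2 ^ k)⁻¹ * (v / t) := by
          rw [div_eq_mul_inv, ENNReal.mul_inv (Or.inl (h2 k)) (Or.inl (h2' k)), div_eq_mul_inv]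
          ring
        have hle : (2 ^ k)⁻¹ * (v / t) ≤ v / t := by
          refine mul_le_of_le_one_left zero_le ?_
          exact ENNReal.inv_le_one.2 (one_le_pow₀ one_le_two)
        calc 2 ^ (k + 1) * (2 * t) * dyadicLLog n (v / (2 ^ k * t))
            ≤ 2 ^ (k + 1) * (2 * t) * ((2 ^ k)⁻¹ * (v / t) * (1 + dyadicCount (v / t)) ^ n) := by
              rw [hdiv, dyadicLLog]
              gcongr
              exact dyadicCount_mono hle
          _ = (2 ^ k * (2 ^ k)⁻¹) * (2 * t * (2 * (v / t * (1 + dyadicCount (v / t)) ^ n))) := by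
              ring
          _ = _ := by rw [ENNReal.mul_inv_cancel (h2 k) (h2' k), one_mul, mul_one, dyadicLLog]
    _ = 2 * t * (2 * dyadicLLog n (v / t)) * dyadicCount (v / t) := by
        rw [ENNReal.tsum_mul_left, dyadicCount]
    _ ≤ 2 * t * (2 * dyadicLLog n (v / t)) * (1 + dyadicCount (v / t)) := by
        gcongr
        exact le_add_self
    _ = _ := by
        unfold dyadicLLog
        ring

/-- The `L (log L) ^ n` weak type estimate for a composition of `n + 1` block maximal operators. -/
theorem exists_volume_lt_iterBlockMaximal_le (s : ℕ → Finset ι) (n : ℕ) :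
    ∃ C : ℝ≥0∞, C ≠ ∞ ∧ ∀ f : (ι → ℝ) → ℝ≥0∞, Measurable f → ∀ t, t ≠ 0 → t ≠ ∞ →
      volume {x | t < iterBlockMaximal s f (n + 1) x} ≤ C * ∫⁻ x, dyadicLLog n (f x / t) := by
  induction n with
  | zero =>
    refine ⟨5 ^ Fintype.card ι, ENNReal.pow_ne_top ofNat_ne_top, fun f hf t ht ht' => ?_⟩
    simp only [dyadicLLog, pow_zero, mul_one, div_eq_mul_inv]
    rw [lintegral_mul_const _ hf, ← mul_assoc, ← div_eq_mul_inv,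
      ENNReal.le_div_iff_mul_le (Or.inl ht) (Or.inl ht'), mul_comm]
    exact mul_volume_lt_blockMaximal_le hf t
  | succ n ih =>
    obtain ⟨C, hCfin, hC⟩ := ih
    have hfin : (5 : ℝ≥0∞) ^ Fintype.card ι * C * 2 ≠ ∞ :=
      ENNReal.mul_ne_top (ENNReal.mul_ne_top (ENNReal.pow_ne_top ofNat_ne_top) hCfin) ofNat_ne_top
    refine ⟨5 ^ Fintype.card ι * C * 2 * (4 * 3 ^ (n + 1)), ENNReal.mul_ne_top hfin
      (ENNReal.mul_ne_top ofNat_ne_top (ENNReal.pow_ne_top ofNat_ne_top)), fun f hf t ht ht' => ?_⟩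
    obtain ⟨u, rfl⟩ : ∃ u, t = 4 * u :=
      ⟨t / 4, (ENNReal.mul_div_cancel (by norm_num) ofNat_ne_top).symm⟩
    have hu : u ≠ 0 := right_ne_zero_of_mul ht
    have hu' : u ≠ ∞ := by
      rintro rfl
      exact ht' (ENNReal.mul_top (by norm_num))
    have hdiv : ∀ x, f x / u = 4 * (f x / (4 * u)) := by
      intro x
      rw [← mul_div_assoc, ENNReal.mul_div_mul_left _ _ (by norm_num) ofNat_ne_top]
    set g := iterBlockMaximal s f (n + 1) with hgdef
    have hg : Measurable g := hf.iterBlockMaximal s _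
    have h2u : 2 * u ≠ 0 := mul_ne_zero two_ne_zero hu
    have h2u' : 2 * u ≠ ∞ := ENNReal.mul_ne_top ofNat_ne_top hu'
    have hg1 : Measurable ({x | 2 * u < g x}.indicator g) :=
      hg.indicator (measurableSet_lt measurable_const hg)
    have hterm : ∀ k : ℕ, volume {x | 2 ^ k * (2 * u) < g x}
        ≤ C * ∫⁻ x, if 2 ^ k * u < f x then dyadicLLog n (f x / (2 ^ k * u)) else 0 := by
      intro k
      rw [mul_left_comm]
      exact volume_two_mul_lt_iterBlockMaximal_le s hC hf
        (mul_ne_zero (pow_ne_zero _ two_ne_zero) hu)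
        (ENNReal.mul_ne_top (ENNReal.pow_ne_top ofNat_ne_top) hu')
    have hmeas : ∀ k : ℕ, Measurable fun x =>
        if 2 ^ k * u < f x then dyadicLLog n (f x / (2 ^ k * u)) else 0 := fun k =>
      Measurable.ite (measurableSet_lt measurable_const hf)
        ((measurable_dyadicLLog n).comp (hf.div_const _)) measurable_const
    have hmeas' : Measurable fun x => dyadicLLog (n + 1) (f x / u) :=
      (measurable_dyadicLLog _).comp (hf.div_const _)
    have main : 2 * u * volume {x | 4 * u < blockMaximal (s (n + 1)) g x}
        ≤ 2 * u * (5 ^ Fintype.card ι * C * 2 * ∫⁻ x, dyadicLLog (n + 1) (f x / u)) := by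
      calc 2 * u * volume {x | 4 * u < blockMaximal (s (n + 1)) g x}
          ≤ 2 * u * volume {x | 2 * u <
              blockMaximal (s (n + 1)) ({x | 2 * u < g x}.indicator g) x} := by
            gcongr 2 * u * volume ?_
            intro x hx
            rw [Set.mem_ofPred_eq] at hx
            have := hx.trans_le (blockMaximal_le_add hg1 (2 * u) (le_indicator_add g (2 * u)) x)
            have h4 : 4 * u = 2 * u + 2 * u := by ring
            rw [h4] at this
            exact (ENNReal.add_lt_add_iff_right h2u').1 this
        _ ≤ 5 ^ Fintype.card ι * ∫⁻ x, {x | 2 * u < g x}.indicator g x :=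
            mul_volume_lt_blockMaximal_le hg1 _
        _ ≤ 5 ^ Fintype.card ι *
              ∑' k : ℕ, 2 ^ (k + 1) * (2 * u) * volume {x | 2 ^ k * (2 * u) < g x} := by
            gcongr
            exact lintegral_indicator_le_tsum hg h2u h2u'
        _ ≤ 5 ^ Fintype.card ι * ∑' k : ℕ, 2 ^ (k + 1) * (2 * u) * (C *
              ∫⁻ x, if 2 ^ k * u < f x then dyadicLLog n (f x / (2 ^ k * u)) else 0) := by
            gcongr with k
            exact hterm k
        _ = 5 ^ Fintype.card ι * (C * ∫⁻ x, ∑' k : ℕ, 2 ^ (k + 1) * (2 * u) *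
              if 2 ^ k * u < f x then dyadicLLog n (f x / (2 ^ k * u)) else 0) := by
            rw [lintegral_tsum fun k => ((hmeas k).const_mul _).aemeasurable,
              ← ENNReal.tsum_mul_left (a := C)]
            congr 1
            refine tsum_congr fun k => ?_
            rw [lintegral_const_mul _ (hmeas k), mul_left_comm]
        _ ≤ 5 ^ Fintype.card ι * (C * ∫⁻ x, 2 * u * (2 * dyadicLLog (n + 1) (f x / u))) := by
            gcongr with x
            exact tsum_dyadicLLog_le n hu hu' (f x)
        _ = _ := by
            rw [lintegral_const_mul _ (hmeas'.const_mul _), lintegral_const_mul _ hmeas']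
            ring
    refine ((ENNReal.mul_le_mul_iff_right h2u h2u').1 main).trans ?_
    rw [mul_assoc _ (4 * 3 ^ (n + 1) : ℝ≥0∞), ← lintegral_const_mul' _ _
      (ENNReal.mul_ne_top ofNat_ne_top (ENNReal.pow_ne_top ofNat_ne_top))]
    gcongr with x
    rw [hdiv]
    exact dyadicLLog_four_mul_le _ _

theorem lmarginal_le_iterBlockMaximal (φ : ι → ℕ) (k : ℕ → ℤ) (m : ι → ℤ)
    {f : (ι → ℝ) → ℝ≥0∞} (hf : Measurable f) (n : ℕ) (x : ι → ℝ)
    (hx : ∀ i, x i ∈ gridInterval (k (φ i)) (m i)) :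
    lmarginal (fun i => volume.restrict (gridInterval (k (φ i)) (m i))) {i | φ i < n} f x
      ≤ (∏ i with φ i < n, ENNReal.ofReal (2 * 2 ^ k (φ i))) *
        iterBlockMaximal (fun j => {i | φ i = j}) f n x := by
  induction n generalizing x with
  | zero => simp [iterBlockMaximal]
  | succ n ih =>
    have hunion : Finset.univ.filter (fun i => φ i < n + 1)
        = Finset.univ.filter (fun i => φ i = n) ∪ Finset.univ.filter (fun i => φ i < n) := by
      ext i
      simp only [Finset.mem_filter, Finset.mem_univ, true_and, Finset.mem_union]
      omega
    have hdisj : Disjoint (Finset.univ.filter fun i => φ i = n)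
        (Finset.univ.filter fun i => φ i < n) :=
      Finset.disjoint_filter.2 fun i _ h => by omega
    set g := iterBlockMaximal (fun j => {i | φ i = j}) f n with hg
    set s : Finset ι := {i | φ i = n} with hs
    set μ : ι → Measure ℝ := fun i => volume.restrict (gridInterval (k (φ i)) (m i)) with hμ
    set P := ∏ i with φ i < n, ENNReal.ofReal (2 * 2 ^ k (φ i)) with hP
    have hPtop : P ≠ ∞ := ENNReal.prod_ne_top fun _ _ => ofReal_ne_top
    have hμs : (fun i : s => μ i) = fun i : s => volume.restrict (gridInterval (k n) (m i)) := by
      funext i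
      have : φ i = n := (Finset.mem_filter.1 i.2).2
      simp only [hμ, this]
    rw [hunion, lmarginal_union μ f hf hdisj, Finset.prod_union hdisj]
    have hprod : ∏ i ∈ s, ENNReal.ofReal (2 * 2 ^ k (φ i))
        = ENNReal.ofReal (2 * 2 ^ k n) ^ s.card := by
      rw [← Finset.prod_const]
      refine Finset.prod_congr rfl fun i hi => ?_
      have : φ i = n := by simpa [hs] using hi
      rw [this]
    have hstep : lmarginal μ s (lmarginal μ (Finset.univ.filter fun i => φ i < n) f) x
        ≤ P * lmarginal (fun i => volume.restrict (gridInterval (k n) (m i))) s g x := by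
      simp only [lmarginal.eq_1 _ s]
      rw [← lintegral_const_mul' _ _ hPtop, hμs, ← Measure.restrict_pi_pi]
      refine setLIntegral_mono_ae' (MeasurableSet.univ_pi fun i =>
        Metric.isClosed_closedBall.measurableSet) (Filter.Eventually.of_forall fun y hy => ?_)
      refine ih _ fun i => ?_
      by_cases hi : i ∈ s
      · have hin : φ i = n := by simpa [hs] using hi
        have := hy ⟨i, hi⟩ (Set.mem_univ _)
        simpa [Function.updateFinset, hi, hin] using this
      · simpa [Function.updateFinset, hi] using hx i
    have hmem : ∀ i ∈ s, x i ∈ gridInterval (k n) (m i) := by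
      intro i hi
      have hin : φ i = n := by simpa [hs] using hi
      have := hx i
      rwa [hin] at this
    have hT : (ENNReal.ofReal (2 * 2 ^ k n) ^ s.card)⁻¹ *
        lmarginal (fun i => volume.restrict (gridInterval (k n) (m i))) s g x
        ≤ blockMaximal s g x := by
      refine le_trans ?_ (le_iSup₂ (k n) m)
      rw [Set.indicator_of_mem (by exact hmem)]
    refine hstep.trans ?_
    rw [hprod, mul_comm _ P, mul_assoc]
    gcongr P * ?_
    rw [mul_comm, ← div_eq_mul_inv, ENNReal.div_le_iff_le_mul (Or.inl (gridWeight_ne_zero _ _))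
      (Or.inl (gridWeight_ne_top _ _)), mul_comm] at hT
    exact hT

/-- Every interval of length at most `2 ^ k` lies in a grid interval of scale `k`. -/
theorem exists_Icc_subset_gridInterval {a b : ℝ} {k : ℤ} (h : b - a ≤ 2 ^ k) :
    ∃ m : ℤ, Set.Icc a b ⊆ gridInterval k m := by
  have hk : (0 : ℝ) < 2 ^ k := by positivity
  refine ⟨⌊a / 2 ^ k⌋, fun y hy => ?_⟩
  have h1 : (⌊a / 2 ^ k⌋ : ℝ) * 2 ^ k ≤ a := (le_div_iff₀ hk).1 (Int.floor_le _)
  have h2 : a < (⌊a / 2 ^ k⌋ + 1) * 2 ^ k := (div_lt_iff₀ hk).1 (Int.lt_floor_add_one _)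
  rw [gridInterval, Real.closedBall_eq_Icc]
  constructor <;> nlinarith [hy.1, hy.2]

theorem setLIntegral_Icc_div_volume_le {c : ℕ} {f : (ι → ℝ) → ℝ≥0∞} (hf : Measurable f)
    {a b x : ι → ℝ} (hab : ∀ i, a i < b i) (φ : ι → Fin c)
    (hφ : ∀ i j, φ i = φ j → b i - a i = b j - a j) (hx : x ∈ Set.Icc a b) :
    (∫⁻ y in Set.Icc a b, f y) / volume (Set.Icc a b)
      ≤ 4 ^ Fintype.card ι * iterBlockMaximal (fun j => {i | (φ i : ℕ) = j}) f c x := by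
  have hkey : ∀ i, ∃ k : ℤ, b i - a i ∈ Set.Ioc ((2 : ℝ) ^ k) (2 ^ (k + 1)) := fun i =>
    exists_mem_Ioc_zpow (sub_pos.2 (hab i)) one_lt_two
  have hk : ∃ k : ℕ → ℤ, ∀ i, b i - a i ≤ 2 ^ k (φ i) ∧ (2 : ℝ) ^ k (φ i) ≤ 2 * (b i - a i) := by
    have : ∀ j : ℕ, ∃ k : ℤ, ∀ i, (φ i : ℕ) = j →
        b i - a i ≤ 2 ^ k ∧ (2 : ℝ) ^ k ≤ 2 * (b i - a i) := by
      intro j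
      by_cases hj : ∃ i, (φ i : ℕ) = j
      · obtain ⟨i, hi⟩ := hj
        obtain ⟨k, hk1, hk2⟩ := hkey i
        refine ⟨k + 1, fun i' hi' => ?_⟩
        rw [hφ i' i (Fin.ext (hi'.trans hi.symm))]
        refine ⟨hk2, ?_⟩
        rw [zpow_add_one₀ two_ne_zero]
        linarith
      · exact ⟨0, fun i hi => absurd ⟨i, hi⟩ hj⟩
    choose k hk using this
    exact ⟨k, fun i => hk _ i rfl⟩
  obtain ⟨k, hk⟩ := hk
  choose m hm using fun i => exists_Icc_subset_gridInterval (hk i).1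
  have hxm : ∀ i, x i ∈ gridInterval (k (φ i)) (m i) := fun i => hm i ⟨hx.1 i, hx.2 i⟩
  have huniv : ({i | (φ i : ℕ) < c} : Finset ι) = Finset.univ := by
    ext i; simp
  have h1 := lmarginal_le_iterBlockMaximal (fun i => (φ i : ℕ)) k m hf c x hxm
  rw [huniv, lmarginal_univ, ← Measure.restrict_pi_pi, ← volume_pi] at h1
  have hsub : Set.Icc a b ⊆ Set.univ.pi fun i => gridInterval (k (φ i)) (m i) := fun y hy i _ =>
    hm i ⟨hy.1 i, hy.2 i⟩
  have hvol : ∏ i, ENNReal.ofReal (2 * 2 ^ k (φ i))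
      ≤ 4 ^ Fintype.card ι * volume (Set.Icc a b) := by
    rw [Real.volume_Icc_pi, ← Finset.card_univ, ← Finset.prod_const, ← Finset.prod_mul_distrib]
    refine Finset.prod_le_prod' fun i _ => ?_
    have h4 : (4 : ℝ≥0∞) = ENNReal.ofReal 4 := by norm_num
    rw [h4, ← ofReal_mul (by norm_num)]
    exact ENNReal.ofReal_le_ofReal (by linarith [(hk i).2])
  refine ENNReal.div_le_of_le_mul ?_
  refine (lintegral_mono_set hsub).trans (h1.trans ?_)
  rw [mul_right_comm]
  gcongr

end Operators

theorem strongMaximal_congr_ae {d c : ℕ} {f g : (Fin d → ℝ) → ℝ≥0∞} (h : f =ᵐ[volume] g) :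
    strongMaximal d c f = strongMaximal d c g := by
  funext x
  simp only [strongMaximal, lintegral_congr_ae (ae_restrict_of_ae h)]

theorem setOf_lt_strongMaximal_subset {d c : ℕ} {f : (Fin d → ℝ) → ℝ≥0∞} (hf : Measurable f)
    (t : ℝ≥0∞) :
    {x | t < strongMaximal d c f x} ⊆ ⋃ φ : Fin d → Fin c,
      {x | t / 4 ^ d < iterBlockMaximal (fun j => {i | (φ i : ℕ) = j}) f c x} := by
  intro x hx
  simp only [strongMaximal, Set.mem_ofPred_eq, lt_iSup_iff] at hx
  obtain ⟨a, b, hab, hcard, hmem, hlt⟩ := hx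
  obtain ⟨φ, hφ⟩ := exists_block_sides _ hcard
  have := hlt.trans_le (setLIntegral_Icc_div_volume_le hf hab φ hφ hmem)
  rw [Fintype.card_fin] at this
  exact Set.mem_iUnion.2 ⟨φ, ENNReal.div_lt_of_lt_mul' this⟩

theorem dyadicLLog_mul_ofReal_le (d n : ℕ) {r : ℝ} (hr : 0 ≤ r) :
    dyadicLLog n (4 ^ d * ENNReal.ofReal r)
      ≤ ENNReal.ofReal (4 ^ d * (2 * (d + 1)) ^ n * 2 ^ n) *
        ENNReal.ofReal (r * (1 + max 0 (Real.log r)) ^ n) := by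
  set L := 1 + max 0 (Real.log r) with hL
  have hL1 : 1 ≤ L := by simp [hL]
  have h : 1 + dyadicCount (4 ^ d * ENNReal.ofReal r)
      ≤ ENNReal.ofReal (2 * (d + 1) * (2 * L)) := by
    have h4 : (4 : ℝ≥0∞) ^ d = 2 ^ (2 * d) := by rw [pow_mul]; norm_num
    rw [h4]
    calc 1 + dyadicCount (2 ^ (2 * d) * ENNReal.ofReal r)
        ≤ 1 + ((2 * d : ℕ) + dyadicCount (ENNReal.ofReal r)) := by
          gcongr
          exact dyadicCount_two_pow_mul_le _ _
      _ = ENNReal.ofReal (2 * d) + (1 + dyadicCount (ENNReal.ofReal r)) := by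
          rw [add_left_comm]; congr 1
          rw [← ENNReal.ofReal_natCast]; push_cast; rfl
      _ ≤ ENNReal.ofReal (2 * d) + ENNReal.ofReal (2 * L) := by
          gcongr
          exact one_add_dyadicCount_ofReal_le r
      _ = ENNReal.ofReal (2 * d + 2 * L) := (ofReal_add (by positivity) (by positivity)).symm
      _ ≤ _ := by
          apply ENNReal.ofReal_le_ofReal
          have : (0 : ℝ) ≤ d := Nat.cast_nonneg d
          nlinarith
  have h4 : (4 : ℝ≥0∞) ^ d = ENNReal.ofReal (4 ^ d) := by
    rw [ofReal_pow (by norm_num)]; norm_num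
  calc dyadicLLog n (4 ^ d * ENNReal.ofReal r)
      ≤ 4 ^ d * ENNReal.ofReal r * ENNReal.ofReal (2 * (d + 1) * (2 * L)) ^ n := by
        unfold dyadicLLog; gcongr
    _ = _ := by
        rw [h4, ← ofReal_pow (by positivity), ← ofReal_mul (by positivity),
          ← ofReal_mul (by positivity), ← ofReal_mul (by positivity)]
        congr 1
        rw [mul_pow, mul_pow 2 L]
        ring

/-- The endpoint (`L(log L)^{c-1}`) estimate for the strong maximal operator of complexity `c`. -/
theorem endpoint_estimate_strong_maximal
    (d c : ℕ) (hd : 1 ≤ d) (hc : 1 ≤ c) (hcd : c ≤ d) :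
    ∃ C : ℝ, 0 < C ∧
      ∀ f : (Fin d → ℝ) → ℝ, LocallyIntegrable f →
      ∀ t : ℝ, 0 < t →
        volume {x | ENNReal.ofReal t <
            strongMaximal d c (fun y => ENNReal.ofReal |f y|) x}
          ≤ ENNReal.ofReal C *
            ∫⁻ x, ENNReal.ofReal
              ((|f x| / t) * (1 + max 0 (Real.log (|f x| / t))) ^ (c - 1)) := by
  obtain ⟨n, rfl⟩ : ∃ n, c = n + 1 := ⟨c - 1, by omega⟩
  choose C hCfin hC using fun φ : Fin d → Fin (n + 1) =>
    exists_volume_lt_iterBlockMaximal_le (fun j => {i | (φ i : ℕ) = j}) n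
  have hsum : ∑ φ, C φ ≠ ∞ := ENNReal.sum_ne_top.2 fun φ _ => hCfin φ
  set K : ℝ := 4 ^ d * (2 * (d + 1)) ^ n * 2 ^ n with hK
  have hKpos : 0 < K := by positivity
  refine ⟨((∑ φ, C φ).toReal + 1) * K, by positivity, fun f hf t ht => ?_⟩
  have hF : AEMeasurable (fun y => ENNReal.ofReal |f y|) :=
    hf.aestronglyMeasurable.aemeasurable.abs.ennreal_ofReal
  obtain ⟨g, hg, hfg⟩ := hF
  have ht0 : ENNReal.ofReal t ≠ 0 := by simpa using ht
  have h4 : (4 : ℝ≥0∞) ^ d ≠ 0 := pow_ne_zero _ (by norm_num)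
  have h4' : (4 : ℝ≥0∞) ^ d ≠ ∞ := ENNReal.pow_ne_top ofNat_ne_top
  rw [strongMaximal_congr_ae hfg]
  have hbound : ∫⁻ x, dyadicLLog n (g x / (ENNReal.ofReal t / 4 ^ d))
      ≤ ENNReal.ofReal K * ∫⁻ x, ENNReal.ofReal
        ((|f x| / t) * (1 + max 0 (Real.log (|f x| / t))) ^ n) := by
    rw [← lintegral_const_mul' _ _ ofReal_ne_top]
    refine lintegral_mono_ae ?_
    filter_upwards [hfg] with x hx
    have : g x / (ENNReal.ofReal t / 4 ^ d) = 4 ^ d * ENNReal.ofReal (|f x| / t) := by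
      rw [← hx, ofReal_div_of_pos ht, div_eq_mul_inv, ENNReal.inv_div (Or.inl h4') (Or.inl h4),
        div_eq_mul_inv, div_eq_mul_inv]
      ring
    rw [this]
    exact dyadicLLog_mul_ofReal_le d n (by positivity)
  rw [Nat.add_sub_cancel, ofReal_mul (by positivity), mul_assoc]
  calc volume {x | ENNReal.ofReal t < strongMaximal d (n + 1) g x}
      ≤ ∑ φ : Fin d → Fin (n + 1), volume {x | ENNReal.ofReal t / 4 ^ d <
          iterBlockMaximal (fun j => {i | (φ i : ℕ) = j}) g (n + 1) x} :=
        (measure_mono (setOf_lt_strongMaximal_subset hg _)).trans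
          (measure_iUnion_fintype_le _ _)
    _ ≤ ∑ φ : Fin d → Fin (n + 1),
          C φ * ∫⁻ x, dyadicLLog n (g x / (ENNReal.ofReal t / 4 ^ d)) := by
        gcongr with φ
        exact hC φ g hg _ (ENNReal.div_ne_zero.2 ⟨ht0, h4'⟩) (ENNReal.div_ne_top ofReal_ne_top h4)
    _ = (∑ φ, C φ) * ∫⁻ x, dyadicLLog n (g x / (ENNReal.ofReal t / 4 ^ d)) := by
        rw [Finset.sum_mul]
    _ ≤ _ := by
        refine mul_le_mul' ?_ hbound
        rw [← ENNReal.ofReal_toReal hsum]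
        exact ENNReal.ofReal_le_ofReal (by rw [ENNReal.ofReal_toReal hsum]; linarith)
end
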